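/- Let H be a set of n planes in ℝ³ in general position. Then the sum over all three-dimensional cells c of the arrangement Arr(H) of the square of the complexity |c| of c is O(n³). Consequently, the number of pairs of edges (e, e') of Arr(H) such that the xy-projections of e and e' cross each other and the unique vertical segment connecting e and e' crosses no other plane of H is O(n³). -/

import Mathlib

open scoped Classical

/-- A non-vertical plane in `ℝ³`, represented by coefficients `(a, b, c)`:
the graph `z = a·x + b·y + c`. -/
abbrev GPlane := ℝ × ℝ × ℝ

/-- The set of points of the plane `h`. -/
def gpset (h : GPlane) : Set (Fin 3 → ℝ) :=
  {x | x 2 = h.1 * x 0 + h.2.1 * x 1 + h.2.2}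

/-- The plane `h` lies strictly (vertically) below the point `z`. -/
def IsBelow (h : GPlane) (z : Fin 3 → ℝ) : Prop :=
  h.1 * z 0 + h.2.1 * z 1 + h.2.2 < z 2

/-- The level of a point `z`: the number of planes of `H` strictly below `z`. -/
noncomputable def levelOf (H : Finset GPlane) (z : Fin 3 → ℝ) : ℕ :=
  (H.filter (fun h => IsBelow h z)).card

/-- The `k`-level of the arrangement of `H`: the closure of the set of points
lying on some plane of `H` at level exactly `k`. -/
noncomputable def kLevel (H : Finset GPlane) (k : ℕ) : Set (Fin 3 → ℝ) :=
  closure {z | (∃ h ∈ H, z ∈ gpset h) ∧ levelOf H z = k}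

/-- The crossing distance: the number of planes of `H` meeting the closed
segment `[p, q]`. -/
noncomputable def crDist (H : Finset GPlane) (p q : Fin 3 → ℝ) : ℕ :=
  (H.filter (fun h => (gpset h ∩ segment ℝ p q).Nonempty)).card

/-- The `xy`-projection of a point of `ℝ³`. -/
def proj2 (z : Fin 3 → ℝ) : Fin 2 → ℝ := ![z 0, z 1]

/-- General position: no two planes are parallel, no three planes share a
common line, and no four planes share a common point. -/
def GenPos (H : Finset GPlane) : Prop :=
  (∀ h₁ ∈ H, ∀ h₂ ∈ H, h₁ ≠ h₂ → (h₁.1, h₁.2.1) ≠ (h₂.1, h₂.2.1)) ∧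
  (∀ h₁ ∈ H, ∀ h₂ ∈ H, ∀ h₃ ∈ H, h₁ ≠ h₂ → h₂ ≠ h₃ → h₁ ≠ h₃ →
    ∀ x y : Fin 3 → ℝ,
      x ∈ gpset h₁ ∩ gpset h₂ ∩ gpset h₃ →
      y ∈ gpset h₁ ∩ gpset h₂ ∩ gpset h₃ → x = y) ∧
  (∀ h₁ ∈ H, ∀ h₂ ∈ H, ∀ h₃ ∈ H, ∀ h₄ ∈ H,
    h₁ ≠ h₂ → h₁ ≠ h₃ → h₁ ≠ h₄ → h₂ ≠ h₃ → h₂ ≠ h₄ → h₃ ≠ h₄ →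
    ¬ ∃ x : Fin 3 → ℝ,
      x ∈ gpset h₁ ∩ gpset h₂ ∩ gpset h₃ ∩ gpset h₄)

/-- A (three-dimensional, open) cell of the arrangement `Arr(H)`:
a connected component of the complement of the union of the planes. -/
def IsCell (H : Finset GPlane) (c : Set (Fin 3 → ℝ)) : Prop :=
  ∃ x : Fin 3 → ℝ, x ∉ ⋃ h ∈ H, gpset h ∧
    c = connectedComponentIn (⋃ h ∈ H, gpset h)ᶜ x

/-- The complexity of a cell: the number of nonempty subsets of at most three
planes of `H` whose common intersection meets the closure of the cell
(counting the facets, edges and vertices on the cell boundary). -/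
noncomputable def cellComplexity (H : Finset GPlane) (c : Set (Fin 3 → ℝ)) : ℕ :=
  (H.powerset.filter (fun S => 1 ≤ S.card ∧ S.card ≤ 3 ∧
    ((⋂ h ∈ S, gpset h) ∩ closure c).Nonempty)).card

/-- The set of vertically aligned pairs of points `(x, y)`, with `x` below `y`,
such that `x` and `y` each lie on (the relative interior of) an edge of the
arrangement — i.e. each lies on two distinct planes of `H` — the
`xy`-projections of the two edges cross (the projected directions are
independent), and the open vertical segment joining `x` to `y` crosses at most
`q` planes of `H`.  Each such pair corresponds to a pair of edges `(e, e')` of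
`Arr(H)` whose projections cross with a connecting vertical segment crossing
at most `q` planes. -/
noncomputable def crossingEdgePairs (H : Finset GPlane) (q : ℕ) :
    Set ((Fin 3 → ℝ) × (Fin 3 → ℝ)) :=
  {z | z.1 0 = z.2 0 ∧ z.1 1 = z.2 1 ∧ z.1 2 < z.2 2 ∧
    ∃ h₁ ∈ H, ∃ h₂ ∈ H, ∃ g₁ ∈ H, ∃ g₂ ∈ H, h₁ ≠ h₂ ∧ g₁ ≠ g₂ ∧
      z.1 ∈ gpset h₁ ∩ gpset h₂ ∧ z.2 ∈ gpset g₁ ∩ gpset g₂ ∧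
      (h₁.1 - h₂.1) * (g₁.2.1 - g₂.2.1) -
        (h₁.2.1 - h₂.2.1) * (g₁.1 - g₂.1) ≠ 0 ∧
      (H.filter (fun h =>
        (gpset h ∩ openSegment ℝ z.1 z.2).Nonempty)).card ≤ q}


/-! ### Signed plane forms -/

/-- The affine form vanishing exactly on the plane `h`, positive above it. -/
noncomputable def planeForm (h : GPlane) (x : Fin 3 → ℝ) : ℝ :=
  x 2 - (h.1 * x 0 + h.2.1 * x 1 + h.2.2)

/-- The sign of the plane `h` in the sign vector with positive part `P`. -/
noncomputable def orient (P : Finset GPlane) (h : GPlane) : ℝ := if h ∈ P then 1 else -1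

/-- The form of `h`, oriented by the sign vector with positive part `P`. -/
noncomputable def signedForm (P : Finset GPlane) (h : GPlane) (x : Fin 3 → ℝ) : ℝ :=
  orient P h * planeForm h x

theorem mem_gpset_iff (h : GPlane) (x : Fin 3 → ℝ) : x ∈ gpset h ↔ planeForm h x = 0 := by
  simp only [gpset, Set.mem_ofPred_eq, planeForm, sub_eq_zero]

theorem orient_mul_self (P : Finset GPlane) (h : GPlane) : orient P h * orient P h = 1 := by
  unfold orient; split_ifs <;> norm_num

theorem orient_ne_zero (P : Finset GPlane) (h : GPlane) : orient P h ≠ 0 := by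
  unfold orient; split_ifs <;> norm_num

theorem orient_erase {P : Finset GPlane} {h r : GPlane} (hr : h ≠ r) :
    orient (P.erase r) h = orient P h := by
  simp [orient, hr]

theorem signedForm_erase {P : Finset GPlane} {h r : GPlane} (hr : h ≠ r) (x : Fin 3 → ℝ) :
    signedForm (P.erase r) h x = signedForm P h x := by
  simp [signedForm, orient_erase hr]

theorem signedForm_eq_zero_iff {P : Finset GPlane} {h : GPlane} {x : Fin 3 → ℝ} :
    signedForm P h x = 0 ↔ planeForm h x = 0 := by
  simp [signedForm, orient_ne_zero]

theorem signedForm_of_mem {P : Finset GPlane} {h : GPlane} (hP : h ∈ P) (x : Fin 3 → ℝ) :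
    signedForm P h x = planeForm h x := by
  simp [signedForm, orient, hP]

theorem signedForm_of_notMem {P : Finset GPlane} {h : GPlane} (hP : h ∉ P) (x : Fin 3 → ℝ) :
    signedForm P h x = -planeForm h x := by
  simp [signedForm, orient, hP]

theorem planeForm_combo (h : GPlane) (x y : Fin 3 → ℝ) {a b : ℝ} (hab : a + b = 1) :
    planeForm h (a • x + b • y) = a * planeForm h x + b * planeForm h y := by
  obtain rfl : b = 1 - a := by linarith
  simp only [planeForm, Pi.add_apply, Pi.smul_apply, smul_eq_mul]
  ring

theorem signedForm_combo (P : Finset GPlane) (h : GPlane) (x y : Fin 3 → ℝ) {a b : ℝ}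
    (hab : a + b = 1) :
    signedForm P h (a • x + b • y) = a * signedForm P h x + b * signedForm P h y := by
  simp only [signedForm, planeForm_combo h x y hab]
  ring

theorem convex_planeForm_eq_zero (h : GPlane) : Convex ℝ {x | planeForm h x = 0} := by
  intro x hx y hy a b _ _ hab
  simp only [Set.mem_ofPred_eq] at hx hy ⊢
  simp [planeForm_combo h x y hab, hx, hy]

/-- Two points on opposite sides of `r` are joined by a segment crossing `r` in its interior. -/
theorem exists_crossing {r : GPlane} {x y : Fin 3 → ℝ} (hx : 0 < planeForm r x)
    (hy : planeForm r y < 0) :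
    ∃ a b : ℝ, 0 < a ∧ 0 < b ∧ a + b = 1 ∧ planeForm r (a • x + b • y) = 0 := by
  have hd : 0 < planeForm r x - planeForm r y := by linarith
  have hab : -planeForm r y / (planeForm r x - planeForm r y) +
      planeForm r x / (planeForm r x - planeForm r y) = 1 := by
    field_simp; ring
  refine ⟨_, _, div_pos (by linarith) hd, div_pos hx hd, hab, ?_⟩
  rw [planeForm_combo r x y hab]
  field_simp; ring

/-! ### Cells and facets as sign vectors -/

/-- `h` contributes a facet to the cell with positive part `P` in the arrangement induced by
`H` on `X`. -/
def IsFacet (X : Set (Fin 3 → ℝ)) (H P : Finset GPlane) (h : GPlane) : Prop :=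
  ∃ x ∈ X, planeForm h x = 0 ∧ ∀ k ∈ H, k ≠ h → 0 < signedForm P k x

/-- The positive parts of the cells of the arrangement induced by `H` on `X`. -/
noncomputable def signCells (X : Set (Fin 3 → ℝ)) (H : Finset GPlane) : Finset (Finset GPlane) :=
  H.powerset.filter (fun P => ∃ x ∈ X, ∀ k ∈ H, 0 < signedForm P k x)

/-- The pairs of a cell and a facet of it. -/
noncomputable def cellFacets (X : Set (Fin 3 → ℝ)) (H : Finset GPlane) :
    Finset (Finset GPlane × GPlane) :=
  (H.powerset ×ˢ H).filter (fun t => IsFacet X H t.1 t.2)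

/-- The triples of a cell and two facets of it. -/
noncomputable def facetPairs (X : Set (Fin 3 → ℝ)) (H : Finset GPlane) :
    Finset (Finset GPlane × GPlane × GPlane) :=
  (H.powerset ×ˢ H ×ˢ H).filter (fun t => IsFacet X H t.1 t.2.1 ∧ IsFacet X H t.1 t.2.2)

theorem mem_signCells {X : Set (Fin 3 → ℝ)} {H P : Finset GPlane} :
    P ∈ signCells X H ↔ P ⊆ H ∧ ∃ x ∈ X, ∀ k ∈ H, 0 < signedForm P k x := by
  simp [signCells]

theorem mem_cellFacets {X : Set (Fin 3 → ℝ)} {H P : Finset GPlane} {h : GPlane} :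
    (P, h) ∈ cellFacets X H ↔ P ⊆ H ∧ h ∈ H ∧ IsFacet X H P h := by
  simp [cellFacets, and_assoc]

theorem mem_facetPairs {X : Set (Fin 3 → ℝ)} {H P : Finset GPlane} {h g : GPlane} :
    (P, h, g) ∈ facetPairs X H ↔
      P ⊆ H ∧ h ∈ H ∧ g ∈ H ∧ IsFacet X H P h ∧ IsFacet X H P g := by
  simp [facetPairs, and_assoc]

/-- Deleting an element `r` from the first components is at most two-to-one; a bound follows
from bounds on the image and on the points with two preimages. -/
theorem card_le_of_erase {β : Type*} (r : GPlane) (A B C : Finset (Finset GPlane × β))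
    (hB : ∀ P b, (P, b) ∈ A → (P.erase r, b) ∈ B)
    (hC : ∀ P Q b, (P, b) ∈ A → (Q, b) ∈ A → r ∈ P → r ∉ Q → P.erase r = Q.erase r →
      (P.erase r, b) ∈ C) :
    A.card ≤ B.card + C.card := by
  set π : Finset GPlane × β → Finset GPlane × β := fun t => (t.1.erase r, t.2) with hπ
  have hpos : ((A.filter (fun t => r ∈ t.1)).image π).card = (A.filter (fun t => r ∈ t.1)).card := by
    refine Finset.card_image_of_injOn ?_
    rintro ⟨P, b⟩ hP ⟨Q, c⟩ hQ h
    simp only [Finset.coe_filter, Set.mem_ofPred_eq] at hP hQ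
    simp only [hπ, Prod.mk.injEq] at h ⊢
    exact ⟨by rw [← Finset.insert_erase hP.2, h.1, Finset.insert_erase hQ.2], h.2⟩
  have hneg : ((A.filter (fun t => r ∉ t.1)).image π).card = (A.filter (fun t => r ∉ t.1)).card := by
    refine Finset.card_image_of_injOn ?_
    rintro ⟨P, b⟩ hP ⟨Q, c⟩ hQ h
    simp only [Finset.coe_filter, Set.mem_ofPred_eq] at hP hQ
    simp only [hπ, Prod.mk.injEq] at h ⊢
    exact ⟨by rw [← Finset.erase_eq_of_notMem hP.2, h.1, Finset.erase_eq_of_notMem hQ.2], h.2⟩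
  rw [← Finset.card_filter_add_card_filter_not (s := A) (fun t => r ∈ t.1), ← hpos, ← hneg,
    ← Finset.card_union_add_card_inter]
  refine Nat.add_le_add (Finset.card_le_card ?_) (Finset.card_le_card ?_)
  · rintro ⟨P, b⟩ hP
    simp only [Finset.mem_union, Finset.mem_image, Finset.mem_filter] at hP
    rcases hP with ⟨t, ⟨ht, -⟩, h⟩ | ⟨t, ⟨ht, -⟩, h⟩ <;> exact h ▸ hB t.1 t.2 ht
  · rintro ⟨P, b⟩ hP
    simp only [Finset.mem_inter, Finset.mem_image, Finset.mem_filter] at hP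
    obtain ⟨⟨⟨Q, c⟩, ⟨hQ, hrQ⟩, h⟩, ⟨R, d⟩, ⟨hR, hrR⟩, h'⟩ := hP
    simp only [hπ, Prod.mk.injEq] at h h'
    obtain ⟨rfl, rfl⟩ := h
    obtain ⟨h', rfl⟩ := h'
    exact hC Q R d hQ hR hrQ hrR h'.symm

/-- The signs with respect to the remaining planes survive at a crossing point of the
deleted plane. -/
theorem signedForm_combo_pos_of_erase_eq {P Q : Finset GPlane} {r k : GPlane} (hk : k ≠ r)
    (hPQ : P.erase r = Q.erase r) {x y : Fin 3 → ℝ} {a b : ℝ} (ha : 0 < a) (hb : 0 < b)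
    (hab : a + b = 1) (hx : 0 < signedForm P k x) (hy : 0 < signedForm Q k y) :
    0 < signedForm (P.erase r) k (a • x + b • y) := by
  rw [signedForm_combo _ _ _ _ hab]
  rw [← signedForm_erase hk] at hx hy
  rw [← hPQ] at hy
  positivity

theorem card_signCells_le {X : Set (Fin 3 → ℝ)} (hX : Convex ℝ X) (H : Finset GPlane)
    (hH : ∀ k ∈ H, {x ∈ X | planeForm k x = 0}.Subsingleton) :
    (signCells X H).card ≤ H.card + 1 := by
  induction H using Finset.induction_on with
  | empty =>
    refine (Finset.card_le_card (Finset.filter_subset _ _)).trans ?_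
    simp
  | insert r H hr ih =>
    have ih := ih (fun k hk => hH k (Finset.mem_insert_of_mem hk))
    have hY : (signCells {x ∈ X | planeForm r x = 0} H).card ≤ 1 := by
      refine Finset.card_le_one.2 fun P hP Q hQ => ?_
      obtain ⟨hPH, x, hx, hPx⟩ := mem_signCells.1 hP
      obtain ⟨hQH, y, hy, hQy⟩ := mem_signCells.1 hQ
      obtain rfl := hH r (Finset.mem_insert_self _ _) hx hy
      ext k
      constructor
      · intro hk
        by_contra hk'
        have h1 := hPx k (hPH hk)
        have h2 := hQy k (hPH hk)
        rw [signedForm_of_mem hk] at h1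
        rw [signedForm_of_notMem hk'] at h2
        linarith
      · intro hk
        by_contra hk'
        have h1 := hPx k (hQH hk)
        have h2 := hQy k (hQH hk)
        rw [signedForm_of_notMem hk'] at h1
        rw [signedForm_of_mem hk] at h2
        linarith
    have key := card_le_of_erase r ((signCells X (insert r H)) ×ˢ ({()} : Finset Unit))
      (signCells X H ×ˢ {()}) (signCells {x ∈ X | planeForm r x = 0} H ×ˢ {()}) ?_ ?_
    · simp only [Finset.card_product, Finset.card_singleton, mul_one] at key
      rw [Finset.card_insert_of_notMem hr]
      omega
    · intro P _ hP
      simp only [Finset.mem_product, mem_signCells, Finset.mem_singleton, and_true] at hP ⊢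
      obtain ⟨hPH, x, hx, hPx⟩ := hP
      refine ⟨fun k hk => ?_, x, hx, fun k hk => ?_⟩
      · rw [Finset.mem_erase] at hk
        exact (Finset.mem_insert.1 (hPH hk.2)).resolve_left hk.1
      · rw [signedForm_erase (ne_of_mem_of_not_mem hk hr)]
        exact hPx k (Finset.mem_insert_of_mem hk)
    · intro P Q _ hP hQ hrP hrQ hPQ
      simp only [Finset.mem_product, mem_signCells, Finset.mem_singleton, and_true] at hP hQ ⊢
      obtain ⟨hPH, x, hx, hPx⟩ := hP
      obtain ⟨hQH, y, hy, hQy⟩ := hQ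
      have h1 := hPx r (Finset.mem_insert_self _ _)
      have h2 := hQy r (Finset.mem_insert_self _ _)
      rw [signedForm_of_mem hrP] at h1
      rw [signedForm_of_notMem hrQ] at h2
      obtain ⟨a, b, ha, hb, hab, h0⟩ := exists_crossing h1 (by linarith : planeForm r y < 0)
      refine ⟨fun k hk => ?_, _, ⟨hX hx hy ha.le hb.le hab, h0⟩, fun k hk => ?_⟩
      · rw [Finset.mem_erase] at hk
        exact (Finset.mem_insert.1 (hPH hk.2)).resolve_left hk.1
      · exact signedForm_combo_pos_of_erase_eq (ne_of_mem_of_not_mem hk hr) hPQ ha hb hab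
          (hPx k (Finset.mem_insert_of_mem hk)) (hQy k (Finset.mem_insert_of_mem hk))

/-- A facet is a cell of the arrangement induced on its plane. -/
theorem card_cellFacets_le (X : Set (Fin 3 → ℝ)) (hX : Convex ℝ X) (H : Finset GPlane)
    (hH : ∀ h ∈ H, ∀ k ∈ H, h ≠ k →
      {x ∈ X | planeForm h x = 0 ∧ planeForm k x = 0}.Subsingleton) :
    (cellFacets X H).card ≤ 2 * H.card ^ 2 := by
  have hfib : ∀ h ∈ H, ((cellFacets X H).filter (fun t => t.2 = h)).card ≤ 2 * H.card := by
    intro h hh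
    have hcell := card_signCells_le (hX.inter (convex_planeForm_eq_zero h)) (H.erase h) (by
      intro k hk
      rw [Finset.mem_erase] at hk
      exact (hH h hh k hk.2 hk.1.symm).anti fun x hx => ⟨hx.1.1, hx.1.2, hx.2⟩)
    rw [Finset.card_erase_of_mem hh, Nat.sub_add_cancel (Finset.card_pos.2 ⟨h, hh⟩)] at hcell
    refine (Finset.card_le_card_of_injOn (fun t => (t.1.erase h, decide (h ∈ t.1)))
      (t := signCells (X ∩ {x | planeForm h x = 0}) (H.erase h) ×ˢ (Finset.univ : Finset Bool))
      ?_ ?_).trans ?_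
    · rintro ⟨P, g⟩ ht
      rw [Finset.mem_coe, Finset.mem_filter, mem_cellFacets] at ht
      obtain ⟨⟨hPH, -, x, hx, hx0, hPx⟩, rfl⟩ := ht
      rw [Finset.mem_coe, Finset.mem_product, mem_signCells]
      refine ⟨⟨Finset.erase_subset_erase _ hPH, x, ⟨hx, hx0⟩, fun k hk => ?_⟩, Finset.mem_univ _⟩
      rw [Finset.mem_erase] at hk
      rw [signedForm_erase hk.1]
      exact hPx k hk.2 hk.1
    · rintro ⟨P, g⟩ ht ⟨Q, g'⟩ ht' heq
      rw [Finset.mem_coe, Finset.mem_filter] at ht ht'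
      obtain ⟨-, rfl⟩ := ht
      obtain ⟨-, h2⟩ := ht'
      simp only [Prod.mk.injEq, decide_eq_decide] at heq h2 ⊢
      refine ⟨?_, h2.symm⟩
      ext k
      by_cases hk : k = g
      · subst hk; exact heq.2
      · have := congrArg (k ∈ ·) heq.1
        simpa [hk] using this
    · rw [Finset.card_product, Finset.card_univ, Fintype.card_bool]
      omega
  have := Finset.card_le_mul_card_image_of_maps_to (s := cellFacets X H) (t := H) (f := Prod.snd)
    (fun t ht => (mem_cellFacets.1 ht).2.1) (2 * H.card) hfib
  calc _ ≤ _ := this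
    _ = _ := by ring

/-! ### Pairs of edges in a planar arrangement -/

/-- The determinant of the gradients that `h` and `k` induce on the plane `p`. -/
noncomputable def planeDet (p h k : GPlane) : ℝ :=
  (p.1 - h.1) * (p.2.1 - k.2.1) - (p.1 - k.1) * (p.2.1 - h.2.1)

theorem exists_planeForm_eq (p h r g : GPlane) (hD : planeDet p h r ≠ 0) :
    ∃ c₀ c₁ : ℝ, ∀ x, planeForm p x = 0 → planeForm g x =
      c₀ + c₁ * planeForm h x + planeDet p h g / planeDet p h r * planeForm r x := by
  refine ⟨(h.2.2 - p.2.2) * (planeDet p g r / planeDet p h r) +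
      (r.2.2 - p.2.2) * (planeDet p h g / planeDet p h r) - (g.2.2 - p.2.2),
    planeDet p g r / planeDet p h r, fun x hx => ?_⟩
  have hx2 : x 2 = p.1 * x 0 + p.2.1 * x 1 + p.2.2 := by
    simpa [planeForm, sub_eq_zero] using hx
  have e : planeForm g x * planeDet p h r = ((h.2.2 - p.2.2) * planeDet p g r +
      (r.2.2 - p.2.2) * planeDet p h g - (g.2.2 - p.2.2) * planeDet p h r) +
      planeDet p g r * planeForm h x + planeDet p h g * planeForm r x := by
    simp only [planeForm, planeDet, hx2]; ring
  field_simp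
  linarith

/-- The determinant of the gradients of `h` and `k` on `p`, with `k` oriented by `P`. -/
noncomputable def orientedDet (P : Finset GPlane) (p h k : GPlane) : ℝ :=
  orient P k * planeDet p h k

theorem exists_signedForm_eq (P : Finset GPlane) (p h r g : GPlane) (hD : planeDet p h r ≠ 0) :
    ∃ c₀ c₁ : ℝ, ∀ x, planeForm p x = 0 → signedForm P g x =
      c₀ + c₁ * signedForm P h x +
        orientedDet P p h g / orientedDet P p h r * signedForm P r x := by
  obtain ⟨c₀, c₁, hc⟩ := exists_planeForm_eq p h r g hD
  refine ⟨orient P g * c₀, orient P g * orient P h * c₁, fun x hx => ?_⟩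
  have h1 := orient_mul_self P h
  have h3 := orient_ne_zero P r
  have e : orientedDet P p h g / orientedDet P p h r * signedForm P r x =
      orient P g * (planeDet p h g / planeDet p h r * planeForm r x) := by
    simp only [orientedDet, signedForm]; field_simp
  rw [e, signedForm, hc x hx, signedForm]
  linear_combination (- orient P g * c₁ * planeForm h x) * h1

theorem exists_signedForm_eq_of_parallel (P : Finset GPlane) (p h r : GPlane)
    (hh : (p.1 - h.1, p.2.1 - h.2.1) ≠ 0) (hD : planeDet p h r = 0) :
    ∃ c₀ c₁ : ℝ, ∀ x, planeForm p x = 0 → signedForm P r x = c₀ + c₁ * signedForm P h x := by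
  have hpos : 0 < (p.1 - h.1) ^ 2 + (p.2.1 - h.2.1) ^ 2 := by
    by_contra hn
    apply hh
    have h1 : p.1 - h.1 = 0 := by nlinarith [sq_nonneg (p.1 - h.1), sq_nonneg (p.2.1 - h.2.1)]
    have h2 : p.2.1 - h.2.1 = 0 := by
      nlinarith [sq_nonneg (p.1 - h.1), sq_nonneg (p.2.1 - h.2.1)]
    simp [h1, h2]
  set N := (p.1 - h.1) ^ 2 + (p.2.1 - h.2.1) ^ 2 with hN
  set c := ((p.1 - h.1) * (p.1 - r.1) + (p.2.1 - h.2.1) * (p.2.1 - r.2.1)) / N with hc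
  have hcN : c * N = (p.1 - h.1) * (p.1 - r.1) + (p.2.1 - h.2.1) * (p.2.1 - r.2.1) := by
    rw [hc]; field_simp
  have e1 : p.1 - r.1 = c * (p.1 - h.1) := by
    apply mul_right_cancel₀ hpos.ne'
    simp only [planeDet] at hD
    linear_combination (- (p.1 - h.1)) * hcN - (p.2.1 - h.2.1) * hD + (p.1 - r.1) * hN
  have e2 : p.2.1 - r.2.1 = c * (p.2.1 - h.2.1) := by
    apply mul_right_cancel₀ hpos.ne'
    simp only [planeDet] at hD
    linear_combination (- (p.2.1 - h.2.1)) * hcN + (p.1 - h.1) * hD + (p.2.1 - r.2.1) * hN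
  refine ⟨orient P r * ((p.2.2 - r.2.2) - c * (p.2.2 - h.2.2)), orient P r * orient P h * c,
    fun x hx => ?_⟩
  have h1 := orient_mul_self P h
  simp only [signedForm]
  have e : planeForm r x = ((p.2.2 - r.2.2) - c * (p.2.2 - h.2.2)) + c * planeForm h x := by
    simp only [planeForm] at hx ⊢
    linear_combination x 0 * e1 + x 1 * e2 + (1 - c) * hx
  rw [e]
  linear_combination (- orient P r * c * planeForm h x) * h1

/-- On the plane `p`, the cell `P` has a further edge `g` such that `r` carries the bounded edge
of the unbounded region cut out by `h`, `r`, `g`. -/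
def IsMiddle (p : GPlane) (I P : Finset GPlane) (h r : GPlane) : Prop :=
  planeDet p h r ≠ 0 ∧ ∃ g ∈ I, g ≠ h ∧ g ≠ r ∧ IsFacet {x | planeForm p x = 0} I P g ∧
    ∃ c₀ c₁ c₂ : ℝ, 0 < c₀ ∧ c₁ < 0 ∧ 0 ≤ c₂ ∧ ∀ x, planeForm p x = 0 →
      signedForm P g x = c₀ + c₁ * signedForm P h x + c₂ * signedForm P r x

/-- If the middle line `r` of the cell `P` also meets `Q`, no line can separate `P`, together with
the crossing of `h` and `r`, from `Q`. -/
theorem IsMiddle.not_separated {p : GPlane} {I P Q : Finset GPlane} {h r s : GPlane}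
    (hm : IsMiddle p I P h r) (hs : s ∈ I) (hsh : s ≠ h) (hsr : s ≠ r) (hhI : h ∈ I) (hrI : r ∈ I)
    (hhr : h ≠ r)
    (hQh : IsFacet {x | planeForm p x = 0} I Q h) (hQr : IsFacet {x | planeForm p x = 0} I Q r)
    (hoh : orient Q h = orient P h) (hor : orient Q r = orient P r)
    (hos : orient Q s = - orient P s) {s₀ s₁ s₂ : ℝ} (hs₀ : 0 < s₀)
    (hse : ∀ x, planeForm p x = 0 →
      signedForm P s x = s₀ + s₁ * signedForm P h x + s₂ * signedForm P r x) : False := by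
  obtain ⟨-, g, hg, hgh, hgr, ⟨w, hw, hwg, hw'⟩, c₀, c₁, c₂, hc₀, hc₁, hc₂, hge⟩ := hm
  obtain ⟨q, hq, hqh, hq'⟩ := hQh
  obtain ⟨y, hy, hyr, hy'⟩ := hQr
  have hFh : ∀ x, signedForm Q h x = signedForm P h x := fun x => by simp [signedForm, hoh]
  have hFr : ∀ x, signedForm Q r x = signedForm P r x := fun x => by simp [signedForm, hor]
  have hFs : ∀ x, signedForm Q s x = -signedForm P s x := fun x => by simp [signedForm, hos]
  have hqr := hq' r hrI hhr.symm
  have hyh := hy' h hhI hhr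
  have hqs := hq' s hs hsh
  have hys := hy' s hs hsr
  rw [hFr] at hqr
  rw [hFh] at hyh
  rw [hFs, hse _ hq, signedForm_eq_zero_iff.2 hqh] at hqs
  rw [hFs, hse _ hy, signedForm_eq_zero_iff.2 hyr] at hys
  have hog : orient Q g = orient P g := by
    by_contra hne
    have hneg : signedForm Q g q = - signedForm P g q := by
      have : orient Q g = - orient P g := by
        unfold orient at hne ⊢; split_ifs at hne ⊢ <;> simp_all
      simp [signedForm, this]
    have := hq' g hg hgh
    rw [hneg, hge _ hq, signedForm_eq_zero_iff.2 hqh] at this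
    nlinarith
  have hgs : g ≠ s := by
    rintro rfl
    have := orient_ne_zero P g
    rw [hog] at hos
    exact this (by linarith)
  have hyg := hy' g hg hgr
  have hFg : signedForm Q g y = signedForm P g y := by simp [signedForm, hog]
  rw [hFg, hge _ hy, signedForm_eq_zero_iff.2 hyr] at hyg
  have hwh := hw' h hhI hgh.symm
  have hwr := hw' r hrI hgr.symm
  have hws := hw' s hs hgs.symm
  rw [hse _ hw] at hws
  have hwg' := hge w hw
  rw [signedForm_eq_zero_iff.2 hwg] at hwg'
  have hs₂ : s₂ < 0 := by
    by_contra hn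
    nlinarith
  have hs₁ : s₁ < 0 := by
    by_contra hn
    nlinarith
  have hlt : signedForm P h y < signedForm P h w := by
    by_contra hn
    nlinarith
  nlinarith

theorem IsMiddle.unique {p : GPlane} {I P Q : Finset GPlane} {h r : GPlane}
    (hP : IsMiddle p I P h r) (hQ : IsMiddle p I Q h r) (hPI : P ⊆ I) (hQI : Q ⊆ I)
    (hhI : h ∈ I) (hrI : r ∈ I) (hhr : h ≠ r)
    (hPh : IsFacet {x | planeForm p x = 0} I P h) (hPr : IsFacet {x | planeForm p x = 0} I P r)
    (hQh : IsFacet {x | planeForm p x = 0} I Q h) (hQr : IsFacet {x | planeForm p x = 0} I Q r)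
    (hoh : h ∈ P ↔ h ∈ Q) (hor : r ∈ P ↔ r ∈ Q) : P = Q := by
  by_contra hne
  obtain ⟨s, hs⟩ : ∃ s, ¬ (s ∈ P ↔ s ∈ Q) := by
    by_contra hcon
    push Not at hcon
    exact hne (Finset.ext hcon)
  have hsI : s ∈ I := by
    by_contra hn
    exact hs (iff_of_false (fun h => hn (hPI h)) (fun h => hn (hQI h)))
  have hsh : s ≠ h := by rintro rfl; exact hs hoh
  have hsr : s ≠ r := by rintro rfl; exact hs hor
  have eh : orient Q h = orient P h := by simp [orient, hoh]
  have er : orient Q r = orient P r := by simp [orient, hor]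
  have es : orient Q s = -orient P s := by
    unfold orient; split_ifs <;> simp_all
  obtain ⟨s₀, s₁, hse⟩ := exists_signedForm_eq P p h r s hP.1
  set s₂ := orientedDet P p h s / orientedDet P p h r
  have hse' : ∀ x, planeForm p x = 0 →
      signedForm Q s x = -s₀ + -s₁ * signedForm Q h x + -s₂ * signedForm Q r x := by
    intro x hx
    have := hse x hx
    simp only [signedForm, eh, er, es] at this ⊢
    linear_combination -this
  rcases lt_trichotomy s₀ 0 with h0 | h0 | h0
  · exact hQ.not_separated hsI hsh hsr hhI hrI hhr hPh hPr eh.symm er.symm (by linarith)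
      (by linarith) hse'
  · obtain ⟨q, hq, hqh, hq'⟩ := hPh
    obtain ⟨y, hy, hyh, hy'⟩ := hQh
    have h1 := hq' s hsI hsh
    have h2 := hy' s hsI hsh
    rw [hse _ hq, signedForm_eq_zero_iff.2 hqh, h0] at h1
    rw [hse' _ hy, signedForm_eq_zero_iff.2 hyh, h0] at h2
    have h3 := hq' r hrI hhr.symm
    have h4 := hy' r hrI hhr.symm
    have : 0 < s₂ := by
      by_contra hn
      nlinarith
    nlinarith
  · exact hP.not_separated hsI hsh hsr hhI hrI hhr hQh hQr eh er es h0 hse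

/-- On each side, and in the parallel class, an edge `h` of a cell has at most one other edge
which is not in the middle. -/
theorem eq_of_not_isMiddle {p : GPlane} {I P : Finset GPlane} {h r r' : GPlane}
    (hh : (p.1 - h.1, p.2.1 - h.2.1) ≠ 0) (hhI : h ∈ I) (hrI : r ∈ I) (hrI' : r' ∈ I)
    (hhr : h ≠ r) (hhr' : h ≠ r')
    (hPh : IsFacet {x | planeForm p x = 0} I P h) (hPr : IsFacet {x | planeForm p x = 0} I P r)
    (hPr' : IsFacet {x | planeForm p x = 0} I P r')
    (hm : ¬ IsMiddle p I P h r) (hm' : ¬ IsMiddle p I P h r')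
    (hsign : SignType.sign (orientedDet P p h r) = SignType.sign (orientedDet P p h r')) :
    r = r' := by
  by_contra hne
  have hPr₀ := hPr
  have hPr₀' := hPr'
  obtain ⟨q, hq, hqh, hq'⟩ := hPh
  obtain ⟨y, hy, hyr, hy'⟩ := hPr
  obtain ⟨w, hw, hwr, hw'⟩ := hPr'
  have hqr := hq' r hrI hhr.symm
  have hqr' := hq' r' hrI' hhr'.symm
  have hyh := hy' h hhI hhr
  have hyr' := hy' r' hrI' (Ne.symm hne)
  have hwh := hw' h hhI hhr'
  have hwr₀ := hw' r hrI hne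
  rw [← signedForm_eq_zero_iff (P := P)] at hqh hyr hwr
  by_cases hD : planeDet p h r = 0
  · have hD' : planeDet p h r' = 0 := by
      simp only [orientedDet, hD, mul_zero, sign_zero] at hsign
      have := sign_eq_zero_iff.1 hsign.symm
      simpa [orient_ne_zero] using this
    obtain ⟨c₀, c₁, hc⟩ := exists_signedForm_eq_of_parallel P p h r hh hD
    obtain ⟨d₀, d₁, hd⟩ := exists_signedForm_eq_of_parallel P p h r' hh hD'
    have e1 := hc y hy
    have e2 := hd w hw
    rw [hc q hq, hqh] at hqr
    rw [hd q hq, hqh] at hqr'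
    rw [hd y hy] at hyr'
    rw [hc w hw] at hwr₀
    have hc₁ : c₁ < 0 := by
      by_contra hn
      nlinarith
    have hd₁ : d₁ < 0 := by
      by_contra hn
      nlinarith
    have l1 : signedForm P h w < signedForm P h y := by
      by_contra hn
      nlinarith
    nlinarith
  · have hδ : orientedDet P p h r ≠ 0 := by simp [orientedDet, orient_ne_zero, hD]
    have hδ' : orientedDet P p h r' ≠ 0 := by
      intro h0
      rw [h0, sign_zero, sign_eq_zero_iff] at hsign
      exact hδ hsign
    have hD' : planeDet p h r' ≠ 0 := by
      intro h0
      simp [orientedDet, h0] at hδ'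
    obtain ⟨c₀, c₁, hc⟩ := exists_signedForm_eq P p h r r' hD
    have hc₂ : 0 < orientedDet P p h r' / orientedDet P p h r := by
      rcases lt_or_gt_of_ne hδ with h1 | h1
      · rw [sign_neg h1] at hsign
        exact div_pos_of_neg_of_neg (sign_eq_neg_one_iff.1 hsign.symm) h1
      · rw [sign_pos h1] at hsign
        exact div_pos (sign_eq_one_iff.1 hsign.symm) h1
    set c₂ := orientedDet P p h r' / orientedDet P p h r
    have e1 := hc w hw
    rw [hc q hq, hqh] at hqr'
    rw [hc y hy, hyr] at hyr'
    rw [hwr] at e1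
    rcases lt_trichotomy c₀ 0 with h0 | h0 | h0
    · refine hm' ⟨hD', r, hrI, hhr.symm, hne, hPr₀, -c₀ / c₂, -c₁ / c₂, 1 / c₂,
        div_pos (by linarith) hc₂, div_neg_of_neg_of_pos ?_ hc₂, by positivity, fun x hx => ?_⟩
      · by_contra hn
        nlinarith
      · rw [hc x hx]
        field_simp
        ring
    · subst h0
      have : 0 < c₁ := by
        by_contra hn
        nlinarith
      have := mul_pos this hwh
      have := mul_pos hc₂ hwr₀
      linarith
    · refine hm ⟨hD, r', hrI', hhr'.symm, Ne.symm hne, hPr₀', c₀, c₁, c₂, h0, ?_, hc₂.le, hc⟩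
      by_contra hn
      have := mul_nonneg (not_lt.1 hn) hwh.le
      have := mul_pos hc₂ hwr₀
      linarith

/-- The planar case: the number of pairs of edges of a common cell is quadratic. -/
theorem card_facetPairs_plane_le (p : GPlane) (I : Finset GPlane)
    (hI : ∀ h ∈ I, (p.1 - h.1, p.2.1 - h.2.1) ≠ 0)
    (hI₂ : ∀ h ∈ I, ∀ k ∈ I, h ≠ k →
      {x ∈ {x | planeForm p x = 0} | planeForm h x = 0 ∧ planeForm k x = 0}.Subsingleton) :
    (facetPairs {x | planeForm p x = 0} I).card ≤ 12 * I.card ^ 2 := by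
  set X := {x | planeForm p x = 0} with hX
  have hF : (cellFacets X I).card ≤ 2 * I.card ^ 2 :=
    card_cellFacets_le X (convex_planeForm_eq_zero p) I hI₂
  set T := facetPairs X I with hT
  set T₁ := T.filter (fun t => t.2.1 = t.2.2)
  set T₂ := (T.filter (fun t => ¬ t.2.1 = t.2.2)).filter (fun t => IsMiddle p I t.1 t.2.1 t.2.2)
  set T₃ := (T.filter (fun t => ¬ t.2.1 = t.2.2)).filter
    (fun t => ¬ IsMiddle p I t.1 t.2.1 t.2.2)
  have hsplit : T.card = T₁.card + (T₂.card + T₃.card) := by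
    rw [Finset.card_filter_add_card_filter_not, Finset.card_filter_add_card_filter_not]
  have h₁ : T₁.card ≤ (cellFacets X I).card := by
    refine Finset.card_le_card_of_injOn (fun t => (t.1, t.2.1)) ?_ ?_
    · rintro ⟨P, h, r⟩ ht
      rw [Finset.mem_coe, Finset.mem_filter, mem_facetPairs] at ht
      exact mem_cellFacets.2 ⟨ht.1.1, ht.1.2.1, ht.1.2.2.2.1⟩
    · rintro ⟨P, h, r⟩ ht ⟨P', h', r'⟩ ht' heq
      rw [Finset.mem_coe, Finset.mem_filter] at ht ht'
      have := ht.2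
      have := ht'.2
      simp_all
  have h₂ : T₂.card ≤ 4 * I.card ^ 2 := by
    refine (Finset.card_le_card_of_injOn
      (fun t => (t.2.1, t.2.2, decide (t.2.1 ∈ t.1), decide (t.2.2 ∈ t.1)))
      (t := I ×ˢ I ×ˢ (Finset.univ : Finset Bool) ×ˢ (Finset.univ : Finset Bool)) ?_ ?_).trans ?_
    · rintro ⟨P, h, r⟩ ht
      rw [Finset.mem_coe, Finset.mem_filter, Finset.mem_filter, mem_facetPairs] at ht
      simp [ht.1.1.2.1, ht.1.1.2.2.1, em]
    · rintro ⟨P, h, r⟩ ht ⟨P', h', r'⟩ ht' heq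
      rw [Finset.mem_coe, Finset.mem_filter, Finset.mem_filter, mem_facetPairs] at ht ht'
      obtain ⟨⟨⟨hPI, hh, hr, hPh, hPr⟩, hne⟩, hm⟩ := ht
      obtain ⟨⟨⟨hPI', -, -, hPh', hPr'⟩, -⟩, hm'⟩ := ht'
      simp only [Prod.mk.injEq, decide_eq_decide] at heq
      obtain ⟨rfl, rfl, e1, e2⟩ := heq
      obtain rfl := hm.unique hm' hPI hPI' hh hr hne hPh hPr hPh' hPr' e1 e2
      rfl
    · simp only [Finset.card_product, Finset.card_univ, Fintype.card_bool]
      exact le_of_eq (by ring)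
  have h₃ : T₃.card ≤ 3 * (cellFacets X I).card := by
    refine (Finset.card_le_card_of_injOn
      (fun t => ((t.1, t.2.1), SignType.sign (orientedDet t.1 p t.2.1 t.2.2)))
      (t := cellFacets X I ×ˢ (Finset.univ : Finset SignType)) ?_ ?_).trans ?_
    · rintro ⟨P, h, r⟩ ht
      rw [Finset.mem_coe, Finset.mem_filter, Finset.mem_filter, mem_facetPairs] at ht
      rw [Finset.mem_coe, Finset.mem_product]
      exact ⟨mem_cellFacets.2 ⟨ht.1.1.1, ht.1.1.2.1, ht.1.1.2.2.2.1⟩, Finset.mem_univ _⟩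
    · rintro ⟨P, h, r⟩ ht ⟨P', h', r'⟩ ht' heq
      rw [Finset.mem_coe, Finset.mem_filter, Finset.mem_filter, mem_facetPairs] at ht ht'
      obtain ⟨⟨⟨hPI, hh, hr, hPh, hPr⟩, hne⟩, hm⟩ := ht
      obtain ⟨⟨⟨-, -, hr', -, hPr'⟩, hne'⟩, hm'⟩ := ht'
      simp only [Prod.mk.injEq] at heq
      obtain ⟨⟨rfl, rfl⟩, e⟩ := heq
      obtain rfl := eq_of_not_isMiddle (hI h hh) hh hr hr' hne hne' hPh hPr hPr' hm hm' e
      rfl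
    · rw [Finset.card_product, Finset.card_univ, show Fintype.card SignType = 3 from rfl, mul_comm]
  omega

/-! ### Pairs of facets in the spatial arrangement -/

theorem GenPos.mono {H I : Finset GPlane} (hH : GenPos H) (hI : I ⊆ H) : GenPos I := by
  refine ⟨fun a ha b hb => hH.1 a (hI ha) b (hI hb),
    fun a ha b hb c hc => hH.2.1 a (hI ha) b (hI hb) c (hI hc),
    fun a ha b hb c hc d hd => hH.2.2 a (hI ha) b (hI hb) c (hI hc) d (hI hd)⟩

theorem GenPos.gradient_ne {H : Finset GPlane} (hH : GenPos H) {h k : GPlane} (hh : h ∈ H)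
    (hk : k ∈ H) (hne : h ≠ k) : (h.1 - k.1, h.2.1 - k.2.1) ≠ 0 := by
  intro h0
  simp only [Prod.mk_eq_zero, sub_eq_zero] at h0
  exact hH.1 h hh k hk hne (by rw [h0.1, h0.2])

theorem GenPos.eq_of_planeForm_eq_zero {H : Finset GPlane} (hH : GenPos H) {h k l : GPlane}
    (hh : h ∈ H) (hk : k ∈ H) (hl : l ∈ H) (hhk : h ≠ k) (hhl : h ≠ l) (hkl : k ≠ l)
    {x y : Fin 3 → ℝ} (hx : planeForm h x = 0 ∧ planeForm k x = 0 ∧ planeForm l x = 0)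
    (hy : planeForm h y = 0 ∧ planeForm k y = 0 ∧ planeForm l y = 0) : x = y := by
  simp only [← mem_gpset_iff] at hx hy
  exact hH.2.1 h hh k hk l hl hhk hkl hhl x y ⟨⟨hx.1, hx.2.1⟩, hx.2.2⟩ ⟨⟨hy.1, hy.2.1⟩, hy.2.2⟩

theorem IsFacet.mono {X : Set (Fin 3 → ℝ)} {H P : Finset GPlane} {h r : GPlane}
    (hf : IsFacet X H P h) : IsFacet X (H.erase r) (P.erase r) h := by
  obtain ⟨x, hx, h0, hpos⟩ := hf
  refine ⟨x, hx, h0, fun k hk hkh => ?_⟩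
  rw [Finset.mem_erase] at hk
  rw [signedForm_erase hk.1]
  exact hpos k hk.2 hkh

/-- If `h` contributes a facet on both sides of `r`, then it contributes one on `r`. -/
theorem IsFacet.restrict {H P Q : Finset GPlane} {h r : GPlane} (hr : r ∈ H)
    (hrh : r ≠ h) (hP : IsFacet Set.univ H P h) (hQ : IsFacet Set.univ H Q h) (hrP : r ∈ P)
    (hrQ : r ∉ Q) (hPQ : P.erase r = Q.erase r) :
    IsFacet {x | planeForm r x = 0} (H.erase r) (P.erase r) h := by
  obtain ⟨x, -, hx0, hx⟩ := hP
  obtain ⟨y, -, hy0, hy⟩ := hQ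
  have h1 := hx r hr hrh
  have h2 := hy r hr hrh
  rw [signedForm_of_mem hrP] at h1
  rw [signedForm_of_notMem hrQ] at h2
  obtain ⟨a, b, ha, hb, hab, h0⟩ := exists_crossing h1 (by linarith : planeForm r y < 0)
  refine ⟨_, h0, ?_, fun k hk hkh => ?_⟩
  · rw [planeForm_combo _ _ _ hab, hx0, hy0]; ring
  · rw [Finset.mem_erase] at hk
    exact signedForm_combo_pos_of_erase_eq hk.1 hPQ ha hb hab (hx k hk.2 hkh) (hy k hk.2 hkh)

theorem card_facetPairs_erase {H : Finset GPlane} (hH : GenPos H) {r : GPlane} (hr : r ∈ H) :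
    ((facetPairs Set.univ H).filter (fun t => r ≠ t.2.1 ∧ r ≠ t.2.2)).card ≤
      (facetPairs Set.univ (H.erase r)).card + 12 * (H.card - 1) ^ 2 := by
  have hplane := card_facetPairs_plane_le r (H.erase r)
    (fun h hh => by
      rw [Finset.mem_erase] at hh
      exact hH.gradient_ne hr hh.2 hh.1.symm)
    (fun h hh k hk hhk x hx y hy => by
      rw [Finset.mem_erase] at hh hk
      exact hH.eq_of_planeForm_eq_zero hr hh.2 hk.2 hh.1.symm hk.1.symm hhk hx hy)
  rw [Finset.card_erase_of_mem hr] at hplane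
  refine (card_le_of_erase r _ (facetPairs Set.univ (H.erase r))
    (facetPairs {x | planeForm r x = 0} (H.erase r)) ?_ ?_).trans (by omega)
  · rintro P ⟨h, g⟩ ht
    simp only [Finset.mem_filter, mem_facetPairs, Finset.mem_erase] at ht ⊢
    obtain ⟨⟨hP, hh, hg, hPh, hPg⟩, hrh, hrg⟩ := ht
    exact ⟨Finset.erase_subset_erase _ hP, ⟨hrh.symm, hh⟩, ⟨hrg.symm, hg⟩, hPh.mono, hPg.mono⟩
  · rintro P Q ⟨h, g⟩ hP hQ hrP hrQ hPQ
    simp only [Finset.mem_filter, mem_facetPairs, Finset.mem_erase] at hP hQ ⊢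
    obtain ⟨⟨hP, hh, hg, hPh, hPg⟩, hrh, hrg⟩ := hP
    obtain ⟨⟨hQ, -, -, hQh, hQg⟩, -, -⟩ := hQ
    exact ⟨Finset.erase_subset_erase _ hP, ⟨hrh.symm, hh⟩, ⟨hrg.symm, hg⟩,
      hPh.restrict hr hrh hQh hrP hrQ hPQ, hPg.restrict hr hrg hQg hrP hrQ hPQ⟩

/-- The number of pairs of facets of a common cell is cubic. -/
theorem card_facetPairs_le {H : Finset GPlane} (hH : GenPos H) :
    (facetPairs Set.univ H).card ≤ 48 * H.card ^ 3 := by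
  induction hn : H.card generalizing H with
  | zero =>
    obtain rfl := Finset.card_eq_zero.1 hn
    simp [facetPairs]
  | succ n ih =>
    rcases Nat.lt_or_ge n 2 with hlt | hge
    · refine (Finset.card_le_card (Finset.filter_subset _ _)).trans ?_
      simp only [Finset.card_product, Finset.card_powerset, hn]
      interval_cases n <;> norm_num
    · have hsum : (n - 1) * (facetPairs Set.univ H).card ≤
          ∑ r ∈ H, ((facetPairs Set.univ H).filter (fun t => r ≠ t.2.1 ∧ r ≠ t.2.2)).card := by
        simp only [Finset.card_filter]
        rw [Finset.sum_comm, mul_comm, ← smul_eq_mul, ← Finset.sum_const]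
        refine Finset.sum_le_sum fun t ht => ?_
        rw [← Finset.card_filter]
        have hsub : (H.erase t.2.1).erase t.2.2 ⊆ H.filter (fun r => r ≠ t.2.1 ∧ r ≠ t.2.2) := by
          intro k hk
          simp only [Finset.mem_erase, Finset.mem_filter] at hk ⊢
          exact ⟨hk.2.2, hk.2.1, hk.1⟩
        have h1 := Finset.card_le_card hsub
        have h2 := Finset.pred_card_le_card_erase (s := H) (a := t.2.1)
        have h3 := Finset.pred_card_le_card_erase (s := H.erase t.2.1) (a := t.2.2)
        omega
      have hle : ∀ r ∈ H, ((facetPairs Set.univ H).filter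
          (fun t => r ≠ t.2.1 ∧ r ≠ t.2.2)).card ≤ 48 * n ^ 3 + 12 * n ^ 2 := by
        intro r hr
        have h1 := card_facetPairs_erase hH hr
        have h2 := ih (hH.mono (Finset.erase_subset r H)) (by
          rw [Finset.card_erase_of_mem hr, hn, Nat.add_sub_cancel])
        rw [hn, Nat.add_sub_cancel] at h1
        omega
      have h3 := hsum.trans (Finset.sum_le_card_nsmul _ _ _ hle)
      rw [hn, smul_eq_mul] at h3
      obtain ⟨m, rfl⟩ := Nat.exists_eq_add_of_le hge
      have e : 2 + m - 1 = m + 1 := by omega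
      rw [e] at h3
      refine Nat.le_of_mul_le_mul_left (h3.trans ?_) (Nat.succ_pos m)
      have : (m + 3) * (48 * (m + 2) ^ 3 + 12 * (m + 2) ^ 2) ≤ (m + 1) * (48 * (m + 3) ^ 3) := by
        have : 48 * (m + 2) ^ 3 + 12 * (m + 2) ^ 2 ≤ (m + 1) * (48 * (m + 3) ^ 2) := by
          nlinarith
        calc _ ≤ (m + 3) * ((m + 1) * (48 * (m + 3) ^ 2)) := Nat.mul_le_mul_left _ this
          _ = _ := by ring
      calc _ = (m + 3) * (48 * (m + 2) ^ 3 + 12 * (m + 2) ^ 2) := by ring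
        _ ≤ _ := this
        _ = _ := by ring

/-! ### The complexity of a cell is linear in its number of facets -/

/-- The point `x` lies in the closed cell with positive part `P`. -/
def InClosedCell (H P : Finset GPlane) (x : Fin 3 → ℝ) : Prop :=
  ∀ k ∈ H, 0 ≤ signedForm P k x

/-- The sets of at most three planes meeting in a point of the closed cell with positive part
`P`. -/
noncomputable def closedFaces (H P : Finset GPlane) : Finset (Finset GPlane) :=
  H.powerset.filter (fun S => 1 ≤ S.card ∧ S.card ≤ 3 ∧
    ∃ x, (∀ h ∈ S, planeForm h x = 0) ∧ InClosedCell H P x)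

/-- The facets of the cell with positive part `P`. -/
noncomputable def facets (H P : Finset GPlane) : Finset GPlane :=
  H.filter (fun h => IsFacet Set.univ H P h)

/-- The translate of `x` parallel to the plane `h` by a vector with projection `(α, β)`. -/
noncomputable def slide (h : GPlane) (x : Fin 3 → ℝ) (α β : ℝ) : Fin 3 → ℝ :=
  ![x 0 + α, x 1 + β, x 2 + (h.1 * α + h.2.1 * β)]

theorem planeForm_slide (h k : GPlane) (x : Fin 3 → ℝ) (α β : ℝ) :
    planeForm k (slide h x α β) =
      planeForm k x + ((h.1 - k.1) * α + (h.2.1 - k.2.1) * β) := by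
  simp only [planeForm, slide, Matrix.cons_val]
  ring

theorem planeForm_slide_self (h : GPlane) (x : Fin 3 → ℝ) (α β : ℝ) :
    planeForm h (slide h x α β) = planeForm h x := by
  simp [planeForm_slide]

theorem GenPos.gradient_sq_pos {H : Finset GPlane} (hH : GenPos H) {h k : GPlane} (hh : h ∈ H)
    (hk : k ∈ H) (hne : h ≠ k) : 0 < (h.1 - k.1) ^ 2 + (h.2.1 - k.2.1) ^ 2 := by
  by_contra hn
  have h1 : h.1 - k.1 = 0 := by nlinarith [sq_nonneg (h.1 - k.1), sq_nonneg (h.2.1 - k.2.1)]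
  have h2 : h.2.1 - k.2.1 = 0 := by
    nlinarith [sq_nonneg (h.1 - k.1), sq_nonneg (h.2.1 - k.2.1)]
  exact hH.gradient_ne hh hk hne (by simp [h1, h2])

theorem GenPos.planeDet_ne_zero {H : Finset GPlane} (hH : GenPos H) {h k l : GPlane}
    (hh : h ∈ H) (hk : k ∈ H) (hl : l ∈ H) (hhk : h ≠ k) (hhl : h ≠ l) (hkl : k ≠ l)
    {x : Fin 3 → ℝ} (hxh : planeForm h x = 0) (hxk : planeForm k x = 0)
    (hxl : planeForm l x = 0) : planeDet h k l ≠ 0 := by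
  intro hD
  have hpos := hH.gradient_sq_pos hh hk hhk
  have heq := hH.eq_of_planeForm_eq_zero hh hk hl hhk hhl hkl ⟨hxh, hxk, hxl⟩
    (y := slide h x (-(h.2.1 - k.2.1)) (h.1 - k.1)) (by
      simp only [planeForm_slide, hxh, hxk, hxl]
      refine ⟨by ring, by ring, ?_⟩
      unfold planeDet at hD
      linear_combination hD)
  have h0 := congrFun heq 0
  have h1 := congrFun heq 1
  simp only [slide, Matrix.cons_val] at h0 h1
  have e0 : h.2.1 - k.2.1 = 0 := by linarith
  have e1 : h.1 - k.1 = 0 := by linarith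
  rw [e0, e1] at hpos
  simp at hpos

theorem GenPos.not_four {H : Finset GPlane} (hH : GenPos H) {a b c d : GPlane} (ha : a ∈ H)
    (hb : b ∈ H) (hc : c ∈ H) (hd : d ∈ H) (hab : a ≠ b) (hac : a ≠ c) (had : a ≠ d)
    (hbc : b ≠ c) (hbd : b ≠ d) (hcd : c ≠ d) {x : Fin 3 → ℝ} (hxa : planeForm a x = 0)
    (hxb : planeForm b x = 0) (hxc : planeForm c x = 0) (hxd : planeForm d x = 0) : False := by
  simp only [← mem_gpset_iff] at hxa hxb hxc hxd
  exact hH.2.2 a ha b hb c hc d hd hab hac had hbc hbd hcd ⟨x, ⟨⟨hxa, hxb⟩, hxc⟩, hxd⟩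

/-- At a point of `h` in the closed cell there is a direction inside `h` that does not leave the
cell and moves away from `j`. -/
theorem GenPos.exists_direction {H P : Finset GPlane} (hH : GenPos H) {h : GPlane} (hh : h ∈ H)
    {x : Fin 3 → ℝ} (hxh : planeForm h x = 0) (j : GPlane) (hj : j ∈ H) (hjh : j ≠ h) :
    ∃ α β : ℝ, (∀ k ∈ H, k ≠ h → planeForm k x = 0 →
        0 ≤ orient P k * ((h.1 - k.1) * α + (h.2.1 - k.2.1) * β)) ∧
      (planeForm j x = 0 → 0 < orient P j * ((h.1 - j.1) * α + (h.2.1 - j.2.1) * β)) := by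
  by_cases hxj : planeForm j x = 0
  swap
  · exact ⟨0, 0, by simp, fun h0 => absurd h0 hxj⟩
  have ho := orient_mul_self P j
  by_cases hex : ∃ k ∈ H, k ≠ h ∧ k ≠ j ∧ planeForm k x = 0
  · obtain ⟨k, hk, hkh, hkj, hxk⟩ := hex
    have hD := hH.planeDet_ne_zero hh hk hj hkh.symm hjh.symm hkj hxh hxk hxj
    set D := planeDet h k j with hDdef
    have hpos : 0 < orient P j * ((h.1 - j.1) * (-(orient P j * D) * (h.2.1 - k.2.1)) +
        (h.2.1 - j.2.1) * (orient P j * D * (h.1 - k.1))) := by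
      have : orient P j * ((h.1 - j.1) * (-(orient P j * D) * (h.2.1 - k.2.1)) +
        (h.2.1 - j.2.1) * (orient P j * D * (h.1 - k.1))) = D ^ 2 := by
        unfold planeDet at hDdef
        linear_combination D ^ 2 * ho - orient P j ^ 2 * D * hDdef
      rw [this]
      positivity
    refine ⟨_, _, fun l hl hlh hxl => ?_, fun _ => hpos⟩
    by_cases hlj : l = j
    · subst hlj; exact hpos.le
    by_cases hlk : l = k
    · subst hlk; apply le_of_eq; ring
    exact (hH.not_four hh hk hj hl hkh.symm hjh.symm (Ne.symm hlh) hkj (Ne.symm hlk) (Ne.symm hlj)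
      hxh hxk hxj hxl).elim
  · have hpos : 0 < orient P j * ((h.1 - j.1) * (orient P j * (h.1 - j.1)) +
        (h.2.1 - j.2.1) * (orient P j * (h.2.1 - j.2.1))) := by
      have := hH.gradient_sq_pos hh hj hjh.symm
      linear_combination this - ((h.1 - j.1) ^ 2 + (h.2.1 - j.2.1) ^ 2) * ho
    refine ⟨_, _, fun l hl hlh hxl => ?_, fun _ => hpos⟩
    by_cases hlj : l = j
    · subst hlj; exact hpos.le
    exact absurd ⟨l, hl, hlh, hlj, hxl⟩ hex

/-- A plane touching the closed cell contributes a facet. -/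
theorem GenPos.isFacet {H P : Finset GPlane} (hH : GenPos H) {h : GPlane} (hh : h ∈ H)
    {x : Fin 3 → ℝ} (hxh : planeForm h x = 0) (hx : InClosedCell H P x) :
    IsFacet Set.univ H P h := by
  choose! α β hnn hpos using hH.exists_direction (P := P) hh hxh
  set a := ∑ j ∈ H.erase h, α j with ha
  set b := ∑ j ∈ H.erase h, β j with hb
  have hL : ∀ k ∈ H, k ≠ h → planeForm k x = 0 →
      0 < orient P k * ((h.1 - k.1) * a + (h.2.1 - k.2.1) * b) := by
    intro k hk hkh hxk
    have : orient P k * ((h.1 - k.1) * a + (h.2.1 - k.2.1) * b) =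
        ∑ j ∈ H.erase h, orient P k * ((h.1 - k.1) * α j + (h.2.1 - k.2.1) * β j) := by
      rw [← Finset.mul_sum, Finset.sum_add_distrib, ← Finset.mul_sum, ← Finset.mul_sum]
    rw [this]
    refine Finset.sum_pos' (fun j hj => ?_) ⟨k, Finset.mem_erase.2 ⟨hkh, hk⟩, hpos k hk hkh hxk⟩
    rw [Finset.mem_erase] at hj
    exact hnn j hj.2 hj.1 k hk hkh hxk
  have hev : ∀ k ∈ H.erase h, ∀ᶠ ε : ℝ in nhdsWithin 0 (Set.Ioi 0),
      0 < signedForm P k (slide h x (ε * a) (ε * b)) := by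
    intro k hk
    rw [Finset.mem_erase] at hk
    have e : ∀ ε : ℝ, signedForm P k (slide h x (ε * a) (ε * b)) = signedForm P k x +
        ε * (orient P k * ((h.1 - k.1) * a + (h.2.1 - k.2.1) * b)) := by
      intro ε
      simp only [signedForm, planeForm_slide]
      ring
    simp only [e]
    rcases (hx k hk.2).lt_or_eq with h0 | h0
    · apply nhdsWithin_le_nhds
      have hc : ContinuousAt (fun ε : ℝ => signedForm P k x +
        ε * (orient P k * ((h.1 - k.1) * a + (h.2.1 - k.2.1) * b))) 0 := by fun_prop
      exact hc.eventually_const_lt (by simpa using h0)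
    · have h1 := hL k hk.2 hk.1 (signedForm_eq_zero_iff.1 h0.symm)
      filter_upwards [self_mem_nhdsWithin] with ε hε
      rw [← h0, zero_add]
      exact mul_pos hε h1
  obtain ⟨ε, hε⟩ := ((Filter.eventually_all_finset _).2 hev).exists
  refine ⟨_, Set.mem_univ _, ?_, fun k hk hkh => hε k (Finset.mem_erase.2 ⟨hkh, hk⟩)⟩
  rw [planeForm_slide_self, hxh]

theorem GenPos.mem_facets {H P : Finset GPlane} (hH : GenPos H) {h : GPlane} (hh : h ∈ H)
    {x : Fin 3 → ℝ} (hxh : planeForm h x = 0) (hx : InClosedCell H P x) : h ∈ facets H P :=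
  Finset.mem_filter.2 ⟨hh, hH.isFacet hh hxh hx⟩

/-- A linear functional on `ℝ³` depending on the slope `t`. -/
noncomputable def height (t : ℝ) (x : Fin 3 → ℝ) : ℝ := x 0 + t * x 1

/-- Some functional is not constant on any line of intersection of two planes. -/
theorem GenPos.exists_generic_slope {H : Finset GPlane} (hH : GenPos H) :
    ∃ t : ℝ, ∀ h ∈ H, ∀ k ∈ H, h ≠ k → (h.2.1 - k.2.1) - t * (h.1 - k.1) ≠ 0 := by
  obtain ⟨t, ht⟩ := Infinite.exists_notMem_finset
    ((H ×ˢ H).image (fun s => (s.1.2.1 - s.2.2.1) / (s.1.1 - s.2.1)))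
  refine ⟨t, fun h hh k hk hne h0 => ht ?_⟩
  refine Finset.mem_image.2 ⟨(h, k), Finset.mem_product.2 ⟨hh, hk⟩, ?_⟩
  have hA : h.1 - k.1 ≠ 0 := by
    intro hA
    rw [hA, mul_zero, sub_zero] at h0
    exact hH.gradient_ne hh hk hne (by simp [hA, h0])
  simp only
  rw [div_eq_iff hA]
  linarith

/-- The rate of change of the height with respect to the form of `i`, along the line of
intersection of `j` and `k`. -/
noncomputable def heightRate (P : Finset GPlane) (t : ℝ) (i j k : GPlane) : ℝ :=
  orient P i * ((k.2.1 - j.2.1) - t * (k.1 - j.1)) / planeDet k i j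

theorem planeDet_swap (k i j : GPlane) : planeDet k j i = -planeDet k i j := by
  unfold planeDet; ring

theorem planeDet_rotate (k i j : GPlane) : planeDet j i k = -planeDet k i j := by
  unfold planeDet; ring

theorem heightRate_swap (P : Finset GPlane) (t : ℝ) (i j k : GPlane) :
    heightRate P t i k j = heightRate P t i j k := by
  unfold heightRate
  rw [planeDet_rotate k i j, div_neg, ← neg_div]
  ring

theorem height_sub {P : Finset GPlane} (t : ℝ) {i j k : GPlane} (hD : planeDet k i j ≠ 0)
    {x y : Fin 3 → ℝ} (hxi : planeForm i x = 0) (hxj : planeForm j x = 0)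
    (hxk : planeForm k x = 0) (hyk : planeForm k y = 0) :
    height t y - height t x =
      signedForm P i y * heightRate P t i j k + signedForm P j y * heightRate P t j i k := by
  have e1 : signedForm P i y * heightRate P t i j k =
      planeForm i y * ((k.2.1 - j.2.1) - t * (k.1 - j.1)) / planeDet k i j := by
    unfold signedForm heightRate
    linear_combination (planeForm i y * ((k.2.1 - j.2.1) - t * (k.1 - j.1)) / planeDet k i j) *
      orient_mul_self P i
  have e2 : signedForm P j y * heightRate P t j i k =
      -(planeForm j y * ((k.2.1 - i.2.1) - t * (k.1 - i.1)) / planeDet k i j) := by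
    unfold signedForm heightRate
    rw [planeDet_swap k i j, div_neg]
    linear_combination -(planeForm j y * ((k.2.1 - i.2.1) - t * (k.1 - i.1)) / planeDet k i j) *
      orient_mul_self P j
  rw [e1, e2]
  have e3 : planeForm i y = (k.1 - i.1) * (y 0 - x 0) + (k.2.1 - i.2.1) * (y 1 - x 1) := by
    unfold planeForm at *
    linear_combination hyk - hxk + hxi
  have e4 : planeForm j y = (k.1 - j.1) * (y 0 - x 0) + (k.2.1 - j.2.1) * (y 1 - x 1) := by
    unfold planeForm at *
    linear_combination hyk - hxk + hxj
  rw [e3, e4]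
  unfold height
  field_simp
  unfold planeDet
  ring

/-- `x` is the unique extreme point, in the direction `ε`, of the closed cell on `h`. -/
def IsExtremeOn (H P : Finset GPlane) (t : ℝ) (x : Fin 3 → ℝ) (h : GPlane) (ε : SignType) : Prop :=
  planeForm h x = 0 ∧ ∀ y, planeForm h y = 0 → InClosedCell H P y →
    0 ≤ (ε : ℝ) * (height t y - height t x) ∧ (height t y = height t x → y = x)

theorem GenPos.isExtremeOn {H P : Finset GPlane} (hH : GenPos H) {t : ℝ} {i j k : GPlane}
    (hi : i ∈ H) (hj : j ∈ H) (hk : k ∈ H) (hij : i ≠ j) (hik : i ≠ k) (hjk : j ≠ k)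
    {x : Fin 3 → ℝ} (hxi : planeForm i x = 0) (hxj : planeForm j x = 0) (hxk : planeForm k x = 0)
    (hpos : 0 < heightRate P t i j k * heightRate P t j i k) :
    ∃ ε : SignType, ε ≠ 0 ∧ IsExtremeOn H P t x k ε := by
  have hD := hH.planeDet_ne_zero hk hi hj hik.symm hjk.symm hij hxk hxi hxj
  set u := heightRate P t i j k
  set v := heightRate P t j i k
  have huniq : ∀ y, planeForm k y = 0 → signedForm P i y = 0 → signedForm P j y = 0 → y = x :=
    fun y hy h1 h2 => hH.eq_of_planeForm_eq_zero hi hj hk hij hik hjk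
      ⟨signedForm_eq_zero_iff.1 h1, signedForm_eq_zero_iff.1 h2, hy⟩ ⟨hxi, hxj, hxk⟩
  rcases pos_and_pos_or_neg_and_neg_of_mul_pos hpos with ⟨hu, hv⟩ | ⟨hu, hv⟩
  · refine ⟨1, by decide, hxk, fun y hyk hy => ?_⟩
    have e := height_sub (P := P) t hD hxi hxj hxk hyk
    have h1 := hy i hi
    have h2 := hy j hj
    rw [SignType.coe_one, one_mul]
    have h3 := mul_nonneg h1 hu.le
    have h4 := mul_nonneg h2 hv.le
    refine ⟨by rw [e]; exact add_nonneg h3 h4, fun heq => ?_⟩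
    rw [heq, sub_self] at e
    have h5 : signedForm P i y * u = 0 := by linarith
    have h6 : signedForm P j y * v = 0 := by linarith
    exact huniq y hyk ((mul_eq_zero.1 h5).resolve_right hu.ne')
      ((mul_eq_zero.1 h6).resolve_right hv.ne')
  · refine ⟨-1, by decide, hxk, fun y hyk hy => ?_⟩
    have e := height_sub (P := P) t hD hxi hxj hxk hyk
    have h1 := hy i hi
    have h2 := hy j hj
    rw [SignType.coe_neg_one]
    have h3 := mul_nonpos_of_nonneg_of_nonpos h1 hu.le
    have h4 := mul_nonpos_of_nonneg_of_nonpos h2 hv.le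
    refine ⟨by rw [e]; linarith, fun heq => ?_⟩
    rw [heq, sub_self] at e
    have h5 : signedForm P i y * u = 0 := by linarith
    have h6 : signedForm P j y * v = 0 := by linarith
    exact huniq y hyk ((mul_eq_zero.1 h5).resolve_right hu.ne)
      ((mul_eq_zero.1 h6).resolve_right hv.ne)

theorem mul_pos_or_mul_pos_or_mul_pos {a b c : ℝ} (ha : a ≠ 0) (hb : b ≠ 0) (hc : c ≠ 0) :
    0 < a * b ∨ 0 < a * c ∨ 0 < b * c := by
  rcases lt_or_gt_of_ne ha with ha | ha <;> rcases lt_or_gt_of_ne hb with hb | hb <;>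
    rcases lt_or_gt_of_ne hc with hc | hc <;>
    simp [mul_pos_of_neg_of_neg, *]

/-- Every vertex is extreme on one of its facets. -/
theorem GenPos.exists_isExtremeOn {H P : Finset GPlane} (hH : GenPos H) {t : ℝ}
    (ht : ∀ h ∈ H, ∀ k ∈ H, h ≠ k → (h.2.1 - k.2.1) - t * (h.1 - k.1) ≠ 0) {i j k : GPlane}
    (hi : i ∈ H) (hj : j ∈ H) (hk : k ∈ H) (hij : i ≠ j) (hik : i ≠ k) (hjk : j ≠ k)
    {x : Fin 3 → ℝ} (hxi : planeForm i x = 0) (hxj : planeForm j x = 0)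
    (hxk : planeForm k x = 0) :
    ∃ h ∈ H, ∃ ε : SignType, ε ≠ 0 ∧ IsExtremeOn H P t x h ε := by
  have hne : ∀ a ∈ H, ∀ b ∈ H, ∀ c ∈ H, a ≠ b → a ≠ c → b ≠ c → planeForm a x = 0 →
      planeForm b x = 0 → planeForm c x = 0 → heightRate P t a b c ≠ 0 := by
    intro a ha b hb c hc hab hac hbc hxa hxb hxc
    exact div_ne_zero (mul_ne_zero (orient_ne_zero P a) (ht c hc b hb hbc.symm))
      (hH.planeDet_ne_zero hc ha hb hac.symm hbc.symm hab hxc hxa hxb)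
  rcases mul_pos_or_mul_pos_or_mul_pos (hne i hi j hj k hk hij hik hjk hxi hxj hxk)
    (hne j hj i hi k hk hij.symm hjk hik hxj hxi hxk)
    (hne k hk i hi j hj hik.symm hjk.symm hij hxk hxi hxj) with h | h | h
  · exact ⟨k, hk, hH.isExtremeOn hi hj hk hij hik hjk hxi hxj hxk h⟩
  · refine ⟨j, hj, hH.isExtremeOn hi hk hj hik hij hjk.symm hxi hxk hxj ?_⟩
    rwa [heightRate_swap]
  · refine ⟨i, hi, hH.isExtremeOn hj hk hi hjk hij.symm hik.symm hxj hxk hxi ?_⟩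
    rwa [heightRate_swap P t j, heightRate_swap P t k]

theorem GenPos.mem_of_card_eq_three {H S : Finset GPlane} (hH : GenPos H) (hS : S ⊆ H)
    (hc : S.card = 3) {x : Fin 3 → ℝ} (hx : ∀ g ∈ S, planeForm g x = 0) {h : GPlane} (hh : h ∈ H)
    (hxh : planeForm h x = 0) : h ∈ S := by
  by_contra hn
  obtain ⟨i, j, k, hij, hik, hjk, rfl⟩ := Finset.card_eq_three.1 hc
  simp only [Finset.insert_subset_iff, Finset.singleton_subset_iff, Finset.mem_insert,
    Finset.mem_singleton, not_or, forall_eq_or_imp, forall_eq] at hS hx hn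
  exact hH.not_four hS.1 hS.2.1 hS.2.2 hh hij hik (Ne.symm hn.1) hjk (Ne.symm hn.2.1)
    (Ne.symm hn.2.2) hx.1 hx.2.1 hx.2.2 hxh

theorem card_vertices_le {H : Finset GPlane} (hH : GenPos H) (P : Finset GPlane) :
    ((closedFaces H P).filter (fun S => S.card = 3)).card ≤ 2 * (facets H P).card := by
  obtain ⟨t, ht⟩ := hH.exists_generic_slope
  have := Finset.card_le_card_of_forall_subsingleton
    (s := (closedFaces H P).filter (fun S => S.card = 3))
    (t := facets H P ×ˢ ({1, -1} : Finset SignType))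
    (fun S b => ∃ x, (∀ g ∈ S, planeForm g x = 0) ∧ InClosedCell H P x ∧
      IsExtremeOn H P t x b.1 b.2) ?_ ?_
  · rw [Finset.card_product, show ({1, -1} : Finset SignType).card = 2 from by decide] at this
    omega
  · intro S hS
    simp only [closedFaces, Finset.mem_filter, Finset.mem_powerset] at hS
    obtain ⟨⟨hSH, -, -, x, hx, hxc⟩, hc⟩ := hS
    obtain ⟨i, j, k, hij, hik, hjk, rfl⟩ := Finset.card_eq_three.1 hc
    simp only [Finset.insert_subset_iff, Finset.singleton_subset_iff] at hSH
    obtain ⟨h, hh, ε, hε, hext⟩ := hH.exists_isExtremeOn (P := P) ht hSH.1 hSH.2.1 hSH.2.2 hij hik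
      hjk (hx i (by simp)) (hx j (by simp)) (hx k (by simp))
    refine ⟨(h, ε), Finset.mem_product.2 ⟨hH.mem_facets hh hext.1 hxc, ?_⟩, x, hx, hxc, hext⟩
    exact (show ∀ ε : SignType, ε ≠ 0 → ε ∈ ({1, -1} : Finset SignType) by decide) ε hε
  · rintro ⟨h, ε⟩ hb S ⟨hS, x, hx, hxc, hext⟩ S' ⟨hS', x', hx', hxc', hext'⟩
    simp only [closedFaces, Finset.mem_filter, Finset.mem_powerset] at hS hS'
    have h1 := hext.2 x' hext'.1 hxc'
    have h2 := hext'.2 x hext.1 hxc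
    have hε : ε = 1 ∨ ε = -1 := by simpa using (Finset.mem_product.1 hb).2
    have heq : height t x' = height t x := by
      rcases hε with rfl | rfl <;>
      · have h3 := h1.1
        have h4 := h2.1
        simp only [SignType.coe_one, SignType.coe_neg_one] at h3 h4
        linarith
    obtain rfl := h1.2 heq
    ext g
    exact ⟨fun hg => hH.mem_of_card_eq_three hS'.1.1 hS'.2 hx' (hS.1.1 hg) (hx g hg),
      fun hg => hH.mem_of_card_eq_three hS.1.1 hS.2 hx (hS'.1.1 hg) (hx' g hg)⟩

/-- The whole line of intersection of `h` and `g` lies in the closed cell. -/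
def IsLineEdge (H P : Finset GPlane) (h g : GPlane) : Prop :=
  (∃ x, planeForm h x = 0 ∧ planeForm g x = 0) ∧
    ∀ y, planeForm h y = 0 → planeForm g y = 0 → InClosedCell H P y

theorem GenPos.isLineEdge_antitone {H P : Finset GPlane} (hH : GenPos H) {h a b : GPlane}
    (hh : h ∈ H) (ha : a ∈ H) (hb : b ∈ H) (hha : h ≠ a) (hhb : h ≠ b) (hab : a ≠ b)
    (hla : IsLineEdge H P h a) (hlb : IsLineEdge H P h b) :
    (∀ x, planeForm h x = 0 → planeForm a x = 0 → 0 < signedForm P b x) ∧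
    ∀ x y, planeForm h x = 0 → planeForm h y = 0 → signedForm P a x < signedForm P a y →
      signedForm P b y < signedForm P b x := by
  obtain ⟨⟨x, hxh, hxa⟩, hxc⟩ := hla
  obtain ⟨⟨y, hyh, hyb⟩, hyc⟩ := hlb
  have hD : planeDet h a b = 0 := by
    by_contra hD
    have ho := orient_ne_zero P b
    set s := -(signedForm P b x + 1) / (orient P b * planeDet h a b) with hs
    have hpt := hxc (slide h x (s * -(h.2.1 - a.2.1)) (s * (h.1 - a.1)))
      (by rw [planeForm_slide_self, hxh])
      (by rw [planeForm_slide, hxa]; ring) b hb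
    have e : signedForm P b (slide h x (s * -(h.2.1 - a.2.1)) (s * (h.1 - a.1))) =
        signedForm P b x + s * (orient P b * planeDet h a b) := by
      simp only [signedForm, planeForm_slide, planeDet]; ring
    rw [e, hs, div_mul_cancel₀ _ (mul_ne_zero ho hD)] at hpt
    linarith
  have hpos : ∀ z, planeForm h z = 0 → planeForm a z = 0 → 0 < signedForm P b z := by
    intro z hzh hza
    refine lt_of_le_of_ne (hxc z hzh hza b hb) fun h0 => ?_
    exact hH.planeDet_ne_zero hh ha hb hha hhb hab hzh hza (signedForm_eq_zero_iff.1 h0.symm) hD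
  refine ⟨hpos, ?_⟩
  obtain ⟨c₀, c₁, hc⟩ := exists_signedForm_eq_of_parallel P h a b (hH.gradient_ne hh ha hha) hD
  have h1 := hpos x hxh hxa
  rw [hc x hxh, signedForm_eq_zero_iff.2 hxa] at h1
  have h2 := hc y hyh
  rw [signedForm_eq_zero_iff.2 hyb] at h2
  have h3 := hyc y hyh hyb a ha
  have h4 : c₁ < 0 := by
    by_contra hn
    nlinarith
  intro z w hz hw hlt
  rw [hc z hz, hc w hw]
  nlinarith

theorem card_lineEdges_le {H P : Finset GPlane} (hH : GenPos H) {h : GPlane} (hh : h ∈ H) :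
    (H.filter (fun g => h ≠ g ∧ IsLineEdge H P h g)).card ≤ 2 := by
  by_contra hn
  obtain ⟨a, b, c, ha, hb, hc, hab, hac, hbc⟩ := Finset.two_lt_card_iff.1 (not_le.1 hn)
  simp only [Finset.mem_filter] at ha hb hc
  obtain ⟨ha, hha, hla⟩ := ha
  obtain ⟨hb, hhb, hlb⟩ := hb
  obtain ⟨hc, hhc, hlc⟩ := hc
  obtain ⟨x, hxh, hxa⟩ := hla.1
  obtain ⟨y, hyh, hyb⟩ := hlb.1
  have h1 := (hH.isLineEdge_antitone hh ha hb hha hhb hab hla hlb).1 x hxh hxa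
  rw [← signedForm_eq_zero_iff.2 hyb] at h1
  have h2 := (hH.isLineEdge_antitone hh hb hc hhb hhc hbc hlb hlc).2 y x hyh hxh h1
  have h3 := (hH.isLineEdge_antitone hh hc ha hhc hha hac.symm hlc hla).2 x y hxh hyh h2
  rw [signedForm_eq_zero_iff.2 hxa] at h3
  exact absurd (hlb.2 y hyh hyb a ha) (not_le.2 h3)

/-- An edge that does not fill its line ends in a vertex. -/
theorem exists_vertex_of_not_isLineEdge {H P : Finset GPlane} {h g : GPlane} {x : Fin 3 → ℝ}
    (hxh : planeForm h x = 0) (hxg : planeForm g x = 0) (hx : InClosedCell H P x)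
    (hl : ¬ IsLineEdge H P h g) :
    ∃ k ∈ H, k ≠ h ∧ k ≠ g ∧ ∃ z, planeForm h z = 0 ∧ planeForm g z = 0 ∧ planeForm k z = 0 ∧
      InClosedCell H P z := by
  obtain ⟨y, hyh, hyg, hy⟩ : ∃ y, planeForm h y = 0 ∧ planeForm g y = 0 ∧
      ¬ InClosedCell H P y := by
    by_contra hcon
    push Not at hcon
    exact hl ⟨⟨x, hxh, hxg⟩, hcon⟩
  set B := H.filter (fun k => signedForm P k y < 0) with hB
  have hBne : B.Nonempty := by
    unfold InClosedCell at hy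
    push Not at hy
    obtain ⟨k, hk, hky⟩ := hy
    exact ⟨k, Finset.mem_filter.2 ⟨hk, hky⟩⟩
  set τ : GPlane → ℝ := fun k => signedForm P k x / (signedForm P k x - signedForm P k y) with hτ
  obtain ⟨k, hkB, hmin⟩ := Finset.exists_min_image B τ hBne
  obtain ⟨hk, hky⟩ := Finset.mem_filter.1 hkB
  have hkx := hx k hk
  have hτ0 : 0 ≤ τ k := div_nonneg hkx (by linarith)
  have hτ1 : τ k ≤ 1 := by
    rw [hτ]
    exact (div_le_one (by linarith)).2 (by linarith)
  have hab : (1 - τ k) + τ k = 1 := by ring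
  refine ⟨k, hk, ?_, ?_, (1 - τ k) • x + τ k • y, ?_, ?_, ?_, fun j hj => ?_⟩
  · rintro rfl
    rw [signedForm_eq_zero_iff.2 hyh] at hky
    exact lt_irrefl _ hky
  · rintro rfl
    rw [signedForm_eq_zero_iff.2 hyg] at hky
    exact lt_irrefl _ hky
  · rw [planeForm_combo _ _ _ hab, hxh, hyh]; ring
  · rw [planeForm_combo _ _ _ hab, hxg, hyg]; ring
  · rw [← signedForm_eq_zero_iff (P := P), signedForm_combo _ _ _ _ hab]
    have : τ k * (signedForm P k x - signedForm P k y) = signedForm P k x := by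
      rw [hτ]
      exact div_mul_cancel₀ _ (by linarith)
    linarith
  · rw [signedForm_combo _ _ _ _ hab]
    have hjx := hx j hj
    by_cases hjy : signedForm P j y < 0
    · have h1 := hmin j (Finset.mem_filter.2 ⟨hj, hjy⟩)
      have h2 : τ j * (signedForm P j x - signedForm P j y) = signedForm P j x := by
        rw [hτ]
        exact div_mul_cancel₀ _ (by linarith)
      nlinarith
    · have h1 := mul_nonneg (sub_nonneg.2 hτ1) hjx
      have h2 := mul_nonneg hτ0 (not_lt.1 hjy)
      linarith

/-- The complexity of a cell is linear in its number of facets. -/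
theorem card_closedFaces_le {H : Finset GPlane} (hH : GenPos H) (P : Finset GPlane) :
    (closedFaces H P).card ≤ 11 * (facets H P).card := by
  set V := (closedFaces H P).filter (fun S => S.card = 3) with hV
  have hVc : V.card ≤ 2 * (facets H P).card := card_vertices_le hH P
  have hsub : closedFaces H P ⊆ (facets H P).image (fun h => {h}) ∪
      ((facets H P).biUnion (fun h => (H.filter (fun g => h ≠ g ∧ IsLineEdge H P h g)).image
        (fun g => {h, g})) ∪ (V.biUnion (fun S => S.powersetCard 2) ∪ V)) := by
    intro S hS
    have hS' := hS
    simp only [closedFaces, Finset.mem_filter, Finset.mem_powerset] at hS'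
    obtain ⟨hSH, hc1, hc3, x, hx, hxc⟩ := hS'
    simp only [Finset.mem_union]
    obtain hc | hc | hc : S.card = 1 ∨ S.card = 2 ∨ S.card = 3 := by omega
    · left
      obtain ⟨h, rfl⟩ := Finset.card_eq_one.1 hc
      exact Finset.mem_image.2 ⟨h, hH.mem_facets (hSH (by simp)) (hx h (by simp)) hxc, rfl⟩
    · right
      obtain ⟨h, g, hhg, rfl⟩ := Finset.card_eq_two.1 hc
      simp only [Finset.insert_subset_iff, Finset.singleton_subset_iff, Finset.mem_insert,
        Finset.mem_singleton, forall_eq_or_imp, forall_eq] at hSH hx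
      by_cases hl : IsLineEdge H P h g
      · left
        exact Finset.mem_biUnion.2 ⟨h, hH.mem_facets hSH.1 hx.1 hxc, Finset.mem_image.2
          ⟨g, Finset.mem_filter.2 ⟨hSH.2, hhg, hl⟩, rfl⟩⟩
      · right; left
        obtain ⟨k, hk, hkh, hkg, z, hzh, hzg, hzk, hz⟩ :=
          exists_vertex_of_not_isLineEdge hx.1 hx.2 hxc hl
        have hcard : ({k, h, g} : Finset GPlane).card = 3 :=
          Finset.card_eq_three.2 ⟨k, h, g, hkh, hkg, hhg, rfl⟩
        refine Finset.mem_biUnion.2 ⟨{k, h, g}, ?_, Finset.mem_powersetCard.2 ⟨?_, hc⟩⟩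
        · simp only [hV, closedFaces, Finset.mem_filter, Finset.mem_powerset, hcard]
          refine ⟨⟨?_, by norm_num, le_rfl, z, ?_, hz⟩, trivial⟩
          · simp [Finset.insert_subset_iff, hk, hSH]
          · simp [hzh, hzg, hzk]
        · exact Finset.subset_insert _ _
    · right; right; right
      exact Finset.mem_filter.2 ⟨hS, hc⟩
  have h1 : ((facets H P).image (fun h => ({h} : Finset GPlane))).card ≤ (facets H P).card :=
    Finset.card_image_le
  have h2 : ((facets H P).biUnion (fun h => (H.filter (fun g => h ≠ g ∧ IsLineEdge H P h g)).image
      (fun g => ({h, g} : Finset GPlane)))).card ≤ (facets H P).card * 2 :=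
    Finset.card_biUnion_le_card_mul _ _ _ fun h hh =>
      Finset.card_image_le.trans (card_lineEdges_le hH (Finset.mem_filter.1 hh).1)
  have h3 : (V.biUnion (fun S => S.powersetCard 2)).card ≤ V.card * 3 :=
    Finset.card_biUnion_le_card_mul _ _ _ fun S hS => by
      rw [Finset.card_powersetCard, (Finset.mem_filter.1 hS).2]
      decide
  have h4 := Finset.card_le_card hsub
  have h5 := Finset.card_union_le ((facets H P).image (fun h => ({h} : Finset GPlane)))
    ((facets H P).biUnion (fun h => (H.filter (fun g => h ≠ g ∧ IsLineEdge H P h g)).image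
        (fun g => {h, g})) ∪ (V.biUnion (fun S => S.powersetCard 2) ∪ V))
  have h6 := Finset.card_union_le
    ((facets H P).biUnion (fun h => (H.filter (fun g => h ≠ g ∧ IsLineEdge H P h g)).image
        (fun g => ({h, g} : Finset GPlane)))) (V.biUnion (fun S => S.powersetCard 2) ∪ V)
  have h7 := Finset.card_union_le (V.biUnion (fun S => S.powersetCard 2)) V
  omega

theorem sum_sq_card_facets_le (H : Finset GPlane) :
    ∑ P ∈ H.powerset, (facets H P).card ^ 2 ≤ (facetPairs Set.univ H).card := by
  have : (H.powerset.sigma fun P => facets H P ×ˢ facets H P).card =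
      ∑ P ∈ H.powerset, (facets H P).card ^ 2 := by
    simp only [Finset.card_sigma, Finset.card_product, sq]
  rw [← this]
  refine Finset.card_le_card_of_injOn (fun s => (s.1, s.2)) ?_ ?_
  · rintro ⟨P, h, g⟩ hs
    simp only [Finset.mem_coe, Finset.mem_sigma, Finset.mem_product, facets, Finset.mem_filter,
      Finset.mem_powerset] at hs
    exact mem_facetPairs.2 ⟨hs.1, hs.2.1.1, hs.2.2.1, hs.2.1.2, hs.2.2.2⟩
  · rintro ⟨P, h⟩ - ⟨Q, g⟩ - heq
    obtain ⟨rfl, rfl⟩ := Prod.mk.inj heq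
    rfl

theorem sum_sq_card_closedFaces_le {H : Finset GPlane} (hH : GenPos H) :
    ∑ P ∈ H.powerset, (closedFaces H P).card ^ 2 ≤ 5808 * H.card ^ 3 := by
  calc ∑ P ∈ H.powerset, (closedFaces H P).card ^ 2
      ≤ ∑ P ∈ H.powerset, 121 * (facets H P).card ^ 2 := by
        refine Finset.sum_le_sum fun P _ => ?_
        calc (closedFaces H P).card ^ 2 ≤ (11 * (facets H P).card) ^ 2 :=
              Nat.pow_le_pow_left (card_closedFaces_le hH P) 2
          _ = 121 * (facets H P).card ^ 2 := by ring
    _ = 121 * ∑ P ∈ H.powerset, (facets H P).card ^ 2 := by rw [Finset.mul_sum]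
    _ ≤ 121 * (48 * H.card ^ 3) :=
        Nat.mul_le_mul_left _ ((sum_sq_card_facets_le H).trans (card_facetPairs_le hH))
    _ = 5808 * H.card ^ 3 := by ring

/-! ### Cells and sign vectors -/

theorem continuous_signedForm (P : Finset GPlane) (h : GPlane) : Continuous (signedForm P h) := by
  unfold signedForm planeForm
  fun_prop

/-- The positive part of the sign vector of `x`. -/
noncomputable def positivePart (H : Finset GPlane) (x : Fin 3 → ℝ) : Finset GPlane :=
  H.filter (fun k => 0 < planeForm k x)

theorem positivePart_subset (H : Finset GPlane) (x : Fin 3 → ℝ) : positivePart H x ⊆ H :=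
  Finset.filter_subset _ _

theorem signedForm_positivePart_pos {H : Finset GPlane} {k : GPlane} (hk : k ∈ H)
    {x : Fin 3 → ℝ} (hx : planeForm k x ≠ 0) : 0 < signedForm (positivePart H x) k x := by
  by_cases h : 0 < planeForm k x
  · rwa [signedForm_of_mem (show k ∈ positivePart H x from Finset.mem_filter.2 ⟨hk, h⟩)]
  · rw [signedForm_of_notMem (show k ∉ positivePart H x from
      fun hm => h (Finset.mem_filter.1 hm).2), neg_pos]
    exact lt_of_le_of_ne (not_lt.1 h) hx

theorem IsCell.exists_positivePart {H : Finset GPlane} {c : Set (Fin 3 → ℝ)} (hc : IsCell H c) :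
    ∃ P ⊆ H, c = {y | ∀ k ∈ H, 0 < signedForm P k y} := by
  obtain ⟨x, hx, rfl⟩ := hc
  set U : Set (Fin 3 → ℝ) := (⋃ h ∈ H, gpset h)ᶜ with hU
  have hmem : ∀ y, y ∈ U ↔ ∀ k ∈ H, planeForm k y ≠ 0 := by
    intro y
    simp [hU, mem_gpset_iff]
  have hxU : x ∈ U := hx
  have hpos : ∀ k ∈ H, 0 < signedForm (positivePart H x) k x := fun k hk =>
    signedForm_positivePart_pos hk ((hmem x).1 hxU k hk)
  refine ⟨positivePart H x, positivePart_subset H x, Set.Subset.antisymm ?_ ?_⟩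
  · intro y hy k hk
    by_contra hn
    obtain ⟨z, hz, hz0⟩ := isPreconnected_connectedComponentIn.intermediate_value hy
      (mem_connectedComponentIn hxU) (continuous_signedForm (positivePart H x) k).continuousOn
      ⟨not_lt.1 hn, (hpos k hk).le⟩
    exact (hmem z).1 (connectedComponentIn_subset U x hz) k hk (signedForm_eq_zero_iff.1 hz0)
  · have hconv : Convex ℝ {y | ∀ k ∈ H, 0 < signedForm (positivePart H x) k y} := by
      intro y hy z hz a b ha hb hab k hk
      rw [signedForm_combo _ _ _ _ hab]
      have h1 := hy k hk
      have h2 := hz k hk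
      rcases ha.eq_or_lt with rfl | ha
      · have : b = 1 := by linarith
        subst this
        linarith
      · positivity
    refine hconv.isPreconnected.subset_connectedComponentIn hpos fun y hy => (hmem y).2 ?_
    intro k hk h0
    exact (hy k hk).ne' (signedForm_eq_zero_iff.2 h0)

theorem cellComplexity_le_card_closedFaces (H P : Finset GPlane) :
    cellComplexity H {y | ∀ k ∈ H, 0 < signedForm P k y} ≤ (closedFaces H P).card := by
  have hcl : closure {y | ∀ k ∈ H, 0 < signedForm P k y} ⊆ {y | InClosedCell H P y} := by
    refine closure_minimal (fun y hy k hk => (hy k hk).le) ?_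
    simp only [InClosedCell, Set.ofPred_forall]
    exact isClosed_biInter fun k _ => isClosed_le continuous_const (continuous_signedForm P k)
  refine Finset.card_le_card fun S hS => ?_
  obtain ⟨hSH, h1, h3, x, hx, hxc⟩ := Finset.mem_filter.1 hS
  refine Finset.mem_filter.2 ⟨hSH, h1, h3, x, fun h hh => ?_, hcl hxc⟩
  rw [← mem_gpset_iff]
  exact Set.mem_iInter₂.1 hx h hh

theorem sum_sq_cellComplexity_le {H : Finset GPlane} (hH : GenPos H)
    {S : Finset (Set (Fin 3 → ℝ))} (hS : ∀ c ∈ S, IsCell H c) :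
    ∑ c ∈ S, cellComplexity H c ^ 2 ≤ 5808 * H.card ^ 3 := by
  choose! p hpH hp using fun c hc => (hS c hc).exists_positivePart
  have hinj : Set.InjOn p S := by
    intro c hc d hd hcd
    rw [hp c hc, hp d hd, hcd]
  calc ∑ c ∈ S, cellComplexity H c ^ 2 ≤ ∑ c ∈ S, (closedFaces H (p c)).card ^ 2 := by
        refine Finset.sum_le_sum fun c hc => Nat.pow_le_pow_left ?_ 2
        conv_lhs => rw [hp c hc]
        exact cellComplexity_le_card_closedFaces H (p c)
    _ = ∑ P ∈ S.image p, (closedFaces H P).card ^ 2 :=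
        (Finset.sum_image (f := fun P => (closedFaces H P).card ^ 2) hinj).symm
    _ ≤ ∑ P ∈ H.powerset, (closedFaces H P).card ^ 2 := by
        refine Finset.sum_le_sum_of_subset fun P hP => ?_
        obtain ⟨c, hc, rfl⟩ := Finset.mem_image.1 hP
        exact Finset.mem_powerset.2 (hpH c hc)
    _ ≤ 5808 * H.card ^ 3 := sum_sq_card_closedFaces_le hH

/-! ### Pairs of edges connected by a vertical segment -/

/-- A segment whose interior avoids all planes lies in a single closed cell. -/
theorem inClosedCell_of_mem_segment {H : Finset GPlane} {x y : Fin 3 → ℝ}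
    (h : ∀ k ∈ H, ∀ z ∈ openSegment ℝ x y, planeForm k z ≠ 0) {z : Fin 3 → ℝ}
    (hz : z ∈ segment ℝ x y) : InClosedCell H (positivePart H (midpoint ℝ x y)) z := by
  intro k hk
  have hm : midpoint ℝ x y ∈ openSegment ℝ x y := midpoint_mem_openSegment x y
  have hpos := signedForm_positivePart_pos hk (h k hk _ hm)
  have hsub : openSegment ℝ x y ⊆ {w | 0 ≤ signedForm (positivePart H (midpoint ℝ x y)) k w} := by
    intro w hw
    by_contra hn
    obtain ⟨v, hv, hv0⟩ := (convex_openSegment x y).isPreconnected.intermediate_value hw hm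
      (continuous_signedForm (positivePart H (midpoint ℝ x y)) k).continuousOn
      ⟨(not_le.1 hn).le, hpos.le⟩
    exact h k hk v hv (signedForm_eq_zero_iff.1 hv0)
  have hcl := closure_minimal hsub (isClosed_le continuous_const (continuous_signedForm _ k))
  rw [closure_openSegment] at hcl
  exact hcl hz

/-- The components of `s` are a closed cell and two of its faces, witnessing that the points of `z`
lie on a crossing pair of edges. -/
def IsCrossingWitness (H : Finset GPlane) (z : (Fin 3 → ℝ) × (Fin 3 → ℝ))
    (s : Σ _ : Finset GPlane, Finset GPlane × Finset GPlane) : Prop :=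
  s ∈ H.powerset.sigma (fun P => closedFaces H P ×ˢ closedFaces H P) ∧
  (∀ h ∈ s.2.1, planeForm h z.1 = 0) ∧ (∀ g ∈ s.2.2, planeForm g z.2 = 0) ∧
  ∃ h₁ ∈ s.2.1, ∃ h₂ ∈ s.2.1, ∃ g₁ ∈ s.2.2, ∃ g₂ ∈ s.2.2,
    (h₁.1 - h₂.1) * (g₁.2.1 - g₂.2.1) - (h₁.2.1 - h₂.2.1) * (g₁.1 - g₂.1) ≠ 0

theorem pair_mem_closedFaces {H P : Finset GPlane} {h g : GPlane} (hh : h ∈ H) (hg : g ∈ H)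
    (hne : h ≠ g) {x : Fin 3 → ℝ} (hxh : planeForm h x = 0) (hxg : planeForm g x = 0)
    (hx : InClosedCell H P x) : {h, g} ∈ closedFaces H P := by
  simp only [closedFaces, Finset.mem_filter, Finset.mem_powerset, Finset.card_pair hne]
  refine ⟨?_, by norm_num, by norm_num, x, ?_, hx⟩
  · simp [Finset.insert_subset_iff, hh, hg]
  · simp [hxh, hxg]

theorem exists_isCrossingWitness {H : Finset GPlane} {z : (Fin 3 → ℝ) × (Fin 3 → ℝ)}
    (hz : z ∈ crossingEdgePairs H 0) : ∃ s, IsCrossingWitness H z s := by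
  obtain ⟨-, -, -, h₁, hh₁, h₂, hh₂, g₁, hg₁, g₂, hg₂, hne, hne', hx, hy, hD, hcard⟩ := hz
  simp only [Set.mem_inter_iff, mem_gpset_iff] at hx hy
  have hempty := Finset.card_eq_zero.1 (Nat.le_zero.1 hcard)
  have havoid : ∀ k ∈ H, ∀ w ∈ openSegment ℝ z.1 z.2, planeForm k w ≠ 0 := by
    intro k hk w hw h0
    exact Finset.filter_eq_empty_iff.1 hempty hk ⟨w, (mem_gpset_iff k w).2 h0, hw⟩
  refine ⟨⟨positivePart H (midpoint ℝ z.1 z.2), {h₁, h₂}, {g₁, g₂}⟩, ?_, by simp [hx],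
    by simp [hy], h₁, by simp, h₂, by simp, g₁, by simp, g₂, by simp, hD⟩
  refine Finset.mem_sigma.2 ⟨Finset.mem_powerset.2 (positivePart_subset _ _),
    Finset.mem_product.2 ⟨?_, ?_⟩⟩
  · exact pair_mem_closedFaces hh₁ hh₂ hne hx.1 hx.2
      (inClosedCell_of_mem_segment havoid (left_mem_segment ℝ _ _))
  · exact pair_mem_closedFaces hg₁ hg₂ hne' hy.1 hy.2
      (inClosedCell_of_mem_segment havoid (right_mem_segment ℝ _ _))

theorem IsCrossingWitness.unique {H : Finset GPlane} {z w : (Fin 3 → ℝ) × (Fin 3 → ℝ)}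
    {s : Σ _ : Finset GPlane, Finset GPlane × Finset GPlane} (hz : z ∈ crossingEdgePairs H 0)
    (hw : w ∈ crossingEdgePairs H 0) (hzs : IsCrossingWitness H z s)
    (hws : IsCrossingWitness H w s) : z = w := by
  obtain ⟨-, hx, hy, h₁, hh₁, h₂, hh₂, g₁, hg₁, g₂, hg₂, hD⟩ := hzs
  obtain ⟨-, hx', hy', -⟩ := hws
  obtain ⟨hz0, hz1, -⟩ := hz
  obtain ⟨hw0, hw1, -⟩ := hw
  have a1 := hx h₁ hh₁
  have a2 := hx h₂ hh₂
  have a3 := hx' h₁ hh₁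
  have a4 := hx' h₂ hh₂
  have b1 := hy g₁ hg₁
  have b2 := hy g₂ hg₂
  have b3 := hy' g₁ hg₁
  have b4 := hy' g₂ hg₂
  unfold planeForm at a1 a2 a3 a4 b1 b2 b3 b4
  rw [← hz0, ← hz1] at b1 b2
  rw [← hw0, ← hw1] at b3 b4
  have p : (h₁.1 - h₂.1) * (z.1 0 - w.1 0) + (h₁.2.1 - h₂.2.1) * (z.1 1 - w.1 1) = 0 := by
    linear_combination a2 - a1 + a3 - a4
  have q : (g₁.1 - g₂.1) * (z.1 0 - w.1 0) + (g₁.2.1 - g₂.2.1) * (z.1 1 - w.1 1) = 0 := by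
    linear_combination b2 - b1 + b3 - b4
  have e0 : z.1 0 = w.1 0 := by
    refine sub_eq_zero.1 ((mul_eq_zero.1 ?_).resolve_left hD)
    linear_combination (g₁.2.1 - g₂.2.1) * p - (h₁.2.1 - h₂.2.1) * q
  have e1 : z.1 1 = w.1 1 := by
    refine sub_eq_zero.1 ((mul_eq_zero.1 ?_).resolve_left hD)
    linear_combination (h₁.1 - h₂.1) * q - (g₁.1 - g₂.1) * p
  rw [e0, e1] at a1 b1
  refine Prod.ext (funext fun i => ?_) (funext fun i => ?_)
  · fin_cases i
    · exact e0
    · exact e1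
    · change z.1 2 = w.1 2
      linarith
  · fin_cases i
    · exact hz0.symm.trans (e0.trans hw0)
    · exact hz1.symm.trans (e1.trans hw1)
    · change z.2 2 = w.2 2
      linarith

theorem crossingEdgePairs_zero_finite_and_ncard_le {H : Finset GPlane} (hH : GenPos H) :
    (crossingEdgePairs H 0).Finite ∧ (crossingEdgePairs H 0).ncard ≤ 5808 * H.card ^ 3 := by
  choose! f hf using fun z => exists_isCrossingWitness (H := H) (z := z)
  set T := H.powerset.sigma (fun P => closedFaces H P ×ˢ closedFaces H P) with hT
  have hmaps : Set.MapsTo f (crossingEdgePairs H 0) T := fun z hz => (hf z hz).1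
  have hinj : Set.InjOn f (crossingEdgePairs H 0) := fun z hz w hw heq =>
    (hf z hz).unique hz hw (heq ▸ hf w hw)
  refine ⟨Set.Finite.of_injOn hmaps hinj T.finite_toSet, ?_⟩
  calc (crossingEdgePairs H 0).ncard
      ≤ (T : Set (Σ _ : Finset GPlane, Finset GPlane × Finset GPlane)).ncard :=
        Set.ncard_le_ncard_of_injOn f (fun _ hz => hmaps hz) hinj T.finite_toSet
    _ = ∑ P ∈ H.powerset, (closedFaces H P).card ^ 2 := by
        simp only [Set.ncard_coe_finset, hT, Finset.card_sigma, Finset.card_product, sq]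
    _ ≤ 5808 * H.card ^ 3 := sum_sq_card_closedFaces_le hH

/-- The sum, over the cells `c` of `Arr(H)`, of `|c|²` is
`O(n³)`; consequently, the number of pairs of edges of `Arr(H)` whose
`xy`-projections cross and whose connecting vertical segment crosses no other
plane of `H` is `O(n³)`. -/
theorem sum_sq_cell_complexity_and_edge_pairs :
    ∃ C : ℝ, 0 < C ∧ ∀ H : Finset GPlane, GenPos H →
      (∀ S : Finset (Set (Fin 3 → ℝ)), (∀ c ∈ S, IsCell H c) →
        (∑ c ∈ S, ((cellComplexity H c : ℝ)) ^ 2) ≤ C * (H.card : ℝ) ^ 3) ∧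
      (crossingEdgePairs H 0).Finite ∧
      ((crossingEdgePairs H 0).ncard : ℝ) ≤ C * (H.card : ℝ) ^ 3 := by
  refine ⟨5808, by norm_num, fun H hH => ?_⟩
  obtain ⟨hfin, hcard⟩ := crossingEdgePairs_zero_finite_and_ncard_le hH
  refine ⟨fun S hS => ?_, hfin, by exact_mod_cast hcard⟩
  exact_mod_cast sum_sq_cellComplexity_le hH hS
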